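/- arXiv:1411.0476 — 6 statements merged into one kernel-verified Lean document; each statement's English description precedes it below -/
import Mathlib

section
/- Let h > 0 and let f : ℝ³ → ℝ be a smooth, everywhere positive function of (n, x, t) satisfying, at every point, the bilinear equations D_x(D_t − (1/4)D_x³) f·f = 0 and (D_x² − (2/h)D_x) f_n·f_{n−h} = 0. Define v := ∂_x ln f, u := ∂_x v, p := ∂_x u, q := ∂_x p, r := ∂_x q. Then at every (n, x, t): (i) ∂_t u = (1/4)r + 3up; (ii) ∂_t v = (1/4)q + (3/2)u²; (iii) p(n+h/2) + p(n−h/2) = (2/h)(u(n+h/2) − u(n−h/2)) − 2(u(n+h/2) − u(n−h/2))(v(n+h/2) − v(n−h/2)); (iv) q(n+h/2) + q(n−h/2) = (2/h)(p(n+h/2) − p(n−h/2)) − 2(p(n+h/2) − p(n−h/2))(v(n+h/2) − v(n−h/2)) − 2(u(n+h/2) − u(n−h/2))²; (v) r(n+h/2) + r(n−h/2) = (2/h)(q(n+h/2) − q(n−h/2)) − 6(p(n+h/2) − p(n−h/2))(u(n+h/2) − u(n−h/2)) − 2(q(n+h/2) − q(n−h/2))(v(n+h/2) − v(n−h/2)),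 where in (iii)–(v) all functions are evaluated at the same (x, t) and only the n-argument is shifted. -/
/-- Hirota bilinear operator `D_x^a D_t^c e^{δ D_n}` applied to a pair of functions
of `(n, x, t)`, evaluated at `(n, x, t)`. -/
noncomputable def hirota3 (a c : ℕ) (δ : ℝ) (A B : ℝ → ℝ → ℝ → ℝ) (n x t : ℝ) : ℝ :=
  iteratedDeriv a (fun r =>
    iteratedDeriv c (fun w => A (n + δ) (x + r) (t + w) * B (n - δ) (x - r) (t - w)) 0) 0

open scoped ContDiff

section PartialDerivatives

variable {G : ℝ → ℝ → ℝ}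

theorem hasDerivAt_fderiv_uncurry_fst (hG : ContDiff ℝ ∞ (Function.uncurry G)) (x t : ℝ) :
    HasDerivAt (fun x' => G x' t) (fderiv ℝ (Function.uncurry G) (x, t) (1, 0)) x := by
  have h1 : HasFDerivAt (Function.uncurry G) _ (x, t) :=
    (hG.differentiable (by simp) (x, t)).hasFDerivAt
  exact h1.comp_hasDerivAt x ((hasDerivAt_id x).prodMk (hasDerivAt_const x t))

theorem hasDerivAt_fderiv_uncurry_snd (hG : ContDiff ℝ ∞ (Function.uncurry G)) (x t : ℝ) :
    HasDerivAt (fun t' => G x t') (fderiv ℝ (Function.uncurry G) (x, t) (0, 1)) t := by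
  have h1 : HasFDerivAt (Function.uncurry G) _ (x, t) :=
    (hG.differentiable (by simp) (x, t)).hasFDerivAt
  exact h1.comp_hasDerivAt t ((hasDerivAt_const t x).prodMk (hasDerivAt_id t))

theorem contDiff_uncurry_deriv_fst (hG : ContDiff ℝ ∞ (Function.uncurry G)) :
    ContDiff ℝ ∞ (Function.uncurry fun x t => deriv (fun x' => G x' t) x) := by
  have h1 : ContDiff ℝ ∞ fun z => fderiv ℝ (Function.uncurry G) z (1, 0) :=
    (hG.fderiv_right (m := ∞) (by simp)).clm_apply contDiff_const
  convert h1 using 1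
  ext ⟨x, t⟩
  exact (hasDerivAt_fderiv_uncurry_fst hG x t).deriv

theorem contDiff_uncurry_deriv_snd (hG : ContDiff ℝ ∞ (Function.uncurry G)) :
    ContDiff ℝ ∞ (Function.uncurry fun x t => deriv (fun t' => G x t') t) := by
  have h1 : ContDiff ℝ ∞ fun z => fderiv ℝ (Function.uncurry G) z (0, 1) :=
    (hG.fderiv_right (m := ∞) (by simp)).clm_apply contDiff_const
  convert h1 using 1
  ext ⟨x, t⟩
  exact (hasDerivAt_fderiv_uncurry_snd hG x t).deriv

theorem hasDerivAt_fst (hG : ContDiff ℝ ∞ (Function.uncurry G)) (x t : ℝ) :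
    HasDerivAt (fun x' => G x' t) (deriv (fun x' => G x' t) x) x :=
  (hasDerivAt_fderiv_uncurry_fst hG x t).differentiableAt.hasDerivAt

theorem hasDerivAt_snd (hG : ContDiff ℝ ∞ (Function.uncurry G)) (x t : ℝ) :
    HasDerivAt (fun t' => G x t') (deriv (fun t' => G x t') t) t :=
  (hasDerivAt_fderiv_uncurry_snd hG x t).differentiableAt.hasDerivAt

theorem deriv_fst_deriv_snd_comm (hG : ContDiff ℝ ∞ (Function.uncurry G)) (x t : ℝ) :
    deriv (fun x' => deriv (fun t' => G x' t') t) x =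
      deriv (fun t' => deriv (fun x' => G x' t') x) t := by
  have hsymm : IsSymmSndFDerivAt ℝ (Function.uncurry G) (x, t) :=
    (contDiff_infty.mp hG 2).contDiffAt.isSymmSndFDerivAt (by simp)
  have h2 : HasFDerivAt (fderiv ℝ (Function.uncurry G))
      (fderiv ℝ (fderiv ℝ (Function.uncurry G)) (x, t)) (x, t) :=
    ((hG.fderiv_right (m := ∞) (by simp)).differentiable (by simp) (x, t)).hasFDerivAt
  have hx : HasDerivAt (fun x' => fderiv ℝ (Function.uncurry G) (x', t))
      (fderiv ℝ (fderiv ℝ (Function.uncurry G)) (x, t) (1, 0)) x :=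
    h2.comp_hasDerivAt x ((hasDerivAt_id x).prodMk (hasDerivAt_const x t))
  have ht : HasDerivAt (fun t' => fderiv ℝ (Function.uncurry G) (x, t'))
      (fderiv ℝ (fderiv ℝ (Function.uncurry G)) (x, t) (0, 1)) t :=
    h2.comp_hasDerivAt t ((hasDerivAt_const t x).prodMk (hasDerivAt_id t))
  simp only [(hasDerivAt_fderiv_uncurry_snd hG _ _).deriv, (hasDerivAt_fderiv_uncurry_fst hG _ _).deriv]
  rw [(hx.clm_apply (hasDerivAt_const x ((0 : ℝ), (1 : ℝ)))).deriv,
    (ht.clm_apply (hasDerivAt_const t ((1 : ℝ), (0 : ℝ)))).deriv, map_zero,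
    hsymm.eq (1, 0) (0, 1)]

end PartialDerivatives

section ExpDerivatives

variable {H H₁ H₂ H₃ H₄ : ℝ → ℝ}

theorem iteratedDeriv_one_exp_comp (h1 : ∀ r, HasDerivAt H (H₁ r) r) :
    iteratedDeriv 1 (fun r => Real.exp (H r)) = fun r => Real.exp (H r) * H₁ r := by
  rw [iteratedDeriv_one]
  funext r
  exact (h1 r).exp.deriv

theorem iteratedDeriv_two_exp_comp (h1 : ∀ r, HasDerivAt H (H₁ r) r)
    (h2 : ∀ r, HasDerivAt H₁ (H₂ r) r) :
    iteratedDeriv 2 (fun r => Real.exp (H r)) =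
      fun r => Real.exp (H r) * (H₂ r + H₁ r ^ 2) := by
  rw [iteratedDeriv_succ, iteratedDeriv_one_exp_comp h1]
  funext r
  rw [((h1 r).exp.fun_mul (h2 r)).deriv]
  ring

theorem iteratedDeriv_four_exp_comp (h1 : ∀ r, HasDerivAt H (H₁ r) r)
    (h2 : ∀ r, HasDerivAt H₁ (H₂ r) r) (h3 : ∀ r, HasDerivAt H₂ (H₃ r) r)
    (h4 : ∀ r, HasDerivAt H₃ (H₄ r) r) :
    iteratedDeriv 4 (fun r => Real.exp (H r)) =
      fun r => Real.exp (H r) * (H₄ r + 4 * H₃ r * H₁ r + 3 * H₂ r ^ 2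
        + 6 * H₂ r * H₁ r ^ 2 + H₁ r ^ 4) := by
  have third : iteratedDeriv 3 (fun r => Real.exp (H r)) =
      fun r => Real.exp (H r) * (H₃ r + 3 * (H₂ r * H₁ r) + H₁ r ^ 3) := by
    rw [iteratedDeriv_succ, iteratedDeriv_two_exp_comp h1 h2]
    funext r
    refine ((h1 r).exp.fun_mul ((h3 r).fun_add ((h2 r).fun_pow 2))).deriv.trans ?_
    norm_num
    ring
  rw [iteratedDeriv_succ, third]
  funext r
  refine ((h1 r).exp.fun_mul (((h4 r).fun_add (((h3 r).fun_mul (h2 r)).const_mul 3)).fun_add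
    ((h2 r).fun_pow 3))).deriv.trans ?_
  norm_num
  ring

end ExpDerivatives

/-- The Hirota derivatives `D_x` and `D_x²` in terms of the logarithms of the two functions. -/
theorem hirota3_zero_shift_exp {A B : ℝ → ℝ → ℝ → ℝ} {n x t : ℝ} {a a₁ a₂ b b₁ b₂ : ℝ → ℝ}
    (hA : ∀ y, A n y t = Real.exp (a y)) (hB : ∀ y, B n y t = Real.exp (b y))
    (ha : ∀ y, HasDerivAt a (a₁ y) y) (ha₁ : ∀ y, HasDerivAt a₁ (a₂ y) y)
    (hb : ∀ y, HasDerivAt b (b₁ y) y) (hb₁ : ∀ y, HasDerivAt b₁ (b₂ y) y) :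
    hirota3 1 0 0 A B n x t = A n x t * B n x t * (a₁ x - b₁ x) ∧
    hirota3 2 0 0 A B n x t = A n x t * B n x t * (a₂ x + b₂ x + (a₁ x - b₁ x) ^ 2) := by
  have h1 : ∀ r, HasDerivAt (fun r => a (x + r) + b (x - r)) (a₁ (x + r) + -b₁ (x - r)) r :=
    fun r => ((ha _).comp_const_add x r).fun_add ((hb _).comp_const_sub _ _)
  have h2 : ∀ r, HasDerivAt (fun r => a₁ (x + r) + -b₁ (x - r))
      (a₂ (x + r) + -(-b₂ (x - r))) r :=
    fun r => ((ha₁ _).comp_const_add x r).fun_add ((hb₁ _).comp_const_sub _ _).fun_neg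
  simp only [hirota3, iteratedDeriv_zero, add_zero, sub_zero, hA, hB, ← Real.exp_add]
  rw [iteratedDeriv_one_exp_comp h1, iteratedDeriv_two_exp_comp h1 h2]
  simp only [add_zero, sub_zero]
  constructor <;> ring

/-- The Hirota derivative `D_x⁴ A·A` in terms of the logarithm of `A`. -/
theorem hirota3_four_self_exp {A : ℝ → ℝ → ℝ → ℝ} {n x t : ℝ} {a a₁ a₂ a₃ a₄ : ℝ → ℝ}
    (hA : ∀ y, A n y t = Real.exp (a y))
    (ha : ∀ y, HasDerivAt a (a₁ y) y) (ha₁ : ∀ y, HasDerivAt a₁ (a₂ y) y)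
    (ha₂ : ∀ y, HasDerivAt a₂ (a₃ y) y) (ha₃ : ∀ y, HasDerivAt a₃ (a₄ y) y) :
    hirota3 4 0 0 A A n x t = A n x t ^ 2 * (2 * a₄ x + 12 * a₂ x ^ 2) := by
  have h1 : ∀ r, HasDerivAt (fun r => a (x + r) + a (x - r)) (a₁ (x + r) + -a₁ (x - r)) r :=
    fun r => ((ha _).comp_const_add x r).fun_add ((ha _).comp_const_sub _ _)
  have h2 : ∀ r, HasDerivAt (fun r => a₁ (x + r) + -a₁ (x - r))
      (a₂ (x + r) + -(-a₂ (x - r))) r :=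
    fun r => ((ha₁ _).comp_const_add x r).fun_add ((ha₁ _).comp_const_sub _ _).fun_neg
  have h3 : ∀ r, HasDerivAt (fun r => a₂ (x + r) + -(-a₂ (x - r)))
      (a₃ (x + r) + -(-(-a₃ (x - r)))) r :=
    fun r => ((ha₂ _).comp_const_add x r).fun_add ((ha₂ _).comp_const_sub _ _).fun_neg.fun_neg
  have h4 : ∀ r, HasDerivAt (fun r => a₃ (x + r) + -(-(-a₃ (x - r))))
      (a₄ (x + r) + -(-(-(-a₄ (x - r))))) r :=
    fun r => ((ha₃ _).comp_const_add x r).fun_add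
      ((ha₃ _).comp_const_sub _ _).fun_neg.fun_neg.fun_neg
  simp only [hirota3, iteratedDeriv_zero, add_zero, sub_zero, hA, ← Real.exp_add]
  rw [iteratedDeriv_four_exp_comp h1 h2 h3 h4, sq (Real.exp _), ← Real.exp_add]
  simp only [add_zero, sub_zero]
  ring

/-- The Hirota derivative `D_x D_t A·A` in terms of the logarithm of `A`. -/
theorem hirota3_one_one_self_exp {A : ℝ → ℝ → ℝ → ℝ} {G : ℝ → ℝ → ℝ} {n : ℝ}
    (hA : ∀ y s, A n y s = Real.exp (G y s)) (hG : ContDiff ℝ ∞ (Function.uncurry G)) (x t : ℝ) :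
    hirota3 1 1 0 A A n x t =
      A n x t ^ 2 * (2 * deriv (fun x' => deriv (fun t' => G x' t') t) x) := by
  have inner : ∀ r w, HasDerivAt (fun w => G (x + r) (t + w) + G (x - r) (t - w))
      (deriv (fun t' => G (x + r) t') (t + w) + -deriv (fun t' => G (x - r) t') (t - w)) w :=
    fun r w => ((hasDerivAt_snd hG (x + r) (t + w)).comp_const_add t w).fun_add
      ((hasDerivAt_snd hG (x - r) (t - w)).comp_const_sub _ _)
  have hGx := fun y => hasDerivAt_fst hG y t
  have hGtx := fun y => hasDerivAt_fst (contDiff_uncurry_deriv_snd hG) y t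
  simp only [hirota3, add_zero, sub_zero, hA, ← Real.exp_add]
  simp only [iteratedDeriv_one_exp_comp (inner _), add_zero, sub_zero, iteratedDeriv_one]
  have outer := (((hGx (x + 0)).comp_const_add x 0).fun_add
      ((hGx (x - 0)).comp_const_sub _ _)).exp.fun_mul
    (((hGtx (x + 0)).comp_const_add x 0).fun_add ((hGtx (x - 0)).comp_const_sub _ _).fun_neg)
  rw [outer.deriv, sq (Real.exp _), ← Real.exp_add]
  simp only [add_zero, sub_zero]
  ring

/-- Theorem 1 (nonlinear form of the semi-discrete KdV system): if `f > 0` is smooth and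
satisfies `D_x(D_t - (1/4)D_x³) f·f = 0` and `(D_x² - (2/h)D_x) f_n·f_{n-h} = 0`, then
`v = (ln f)_x`, `u = v_x`, `p = u_x`, `q = p_x`, `r = q_x` satisfy the semi-discrete
KdV equations. -/
theorem semidiscrete_KdV_nonlinear_form
    (h : ℝ) (hh : 0 < h) (f : ℝ → ℝ → ℝ → ℝ)
    (hf : ContDiff ℝ (⊤ : ℕ∞) (fun pt : ℝ × ℝ × ℝ => f pt.1 pt.2.1 pt.2.2))
    (hfpos : ∀ n x t, 0 < f n x t)
    (heq1 : ∀ n x t,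
      hirota3 1 1 0 f f n x t - (1/4) * hirota3 4 0 0 f f n x t = 0)
    (heq2 : ∀ n x t,
      hirota3 2 0 0 f (fun n' x' t' => f (n' - h) x' t') n x t
        - (2/h) * hirota3 1 0 0 f (fun n' x' t' => f (n' - h) x' t') n x t = 0)
    (v u p q r : ℝ → ℝ → ℝ → ℝ)
    (hv : ∀ n x t, v n x t = deriv (fun x' => Real.log (f n x' t)) x)
    (hu : ∀ n x t, u n x t = deriv (fun x' => v n x' t) x)
    (hp : ∀ n x t, p n x t = deriv (fun x' => u n x' t) x)
    (hq : ∀ n x t, q n x t = deriv (fun x' => p n x' t) x)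
    (hr : ∀ n x t, r n x t = deriv (fun x' => q n x' t) x) :
    ∀ n x t,
      (deriv (fun t' => u n x t') t = (1/4) * r n x t + 3 * u n x t * p n x t) ∧
      (deriv (fun t' => v n x t') t = (1/4) * q n x t + (3/2) * (u n x t)^2) ∧
      (p (n + h/2) x t + p (n - h/2) x t =
        (2/h) * (u (n + h/2) x t - u (n - h/2) x t)
          - 2 * (u (n + h/2) x t - u (n - h/2) x t)
              * (v (n + h/2) x t - v (n - h/2) x t)) ∧
      (q (n + h/2) x t + q (n - h/2) x t =
        (2/h) * (p (n + h/2) x t - p (n - h/2) x t)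
          - 2 * (p (n + h/2) x t - p (n - h/2) x t)
              * (v (n + h/2) x t - v (n - h/2) x t)
          - 2 * (u (n + h/2) x t - u (n - h/2) x t)^2) ∧
      (r (n + h/2) x t + r (n - h/2) x t =
        (2/h) * (q (n + h/2) x t - q (n - h/2) x t)
          - 6 * (p (n + h/2) x t - p (n - h/2) x t)
              * (u (n + h/2) x t - u (n - h/2) x t)
          - 2 * (q (n + h/2) x t - q (n - h/2) x t)
              * (v (n + h/2) x t - v (n - h/2) x t)) := by
  have hL : ∀ n, ContDiff ℝ ∞ (Function.uncurry fun x t => Real.log (f n x t)) := fun n => by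
    have hfn : ContDiff ℝ ∞ (Function.uncurry (f n)) :=
      hf.comp (contDiff_const (c := n) |>.prodMk contDiff_id)
    exact hfn.log fun z => (hfpos n z.1 z.2).ne'
  have hvS : ∀ n, ContDiff ℝ ∞ (Function.uncurry (v n)) := fun n => by
    have : v n = _ := funext₂ (hv n)
    exact this ▸ contDiff_uncurry_deriv_fst (hL n)
  have huS : ∀ n, ContDiff ℝ ∞ (Function.uncurry (u n)) := fun n => by
    have : u n = _ := funext₂ (hu n)
    exact this ▸ contDiff_uncurry_deriv_fst (hvS n)
  have hpS : ∀ n, ContDiff ℝ ∞ (Function.uncurry (p n)) := fun n => by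
    have : p n = _ := funext₂ (hp n)
    exact this ▸ contDiff_uncurry_deriv_fst (huS n)
  have hqS : ∀ n, ContDiff ℝ ∞ (Function.uncurry (q n)) := fun n => by
    have : q n = _ := funext₂ (hq n)
    exact this ▸ contDiff_uncurry_deriv_fst (hpS n)
  have dL : ∀ n t x, HasDerivAt (fun x' => Real.log (f n x' t)) (v n x t) x := fun n t x => by
    rw [hv]; exact hasDerivAt_fst (hL n) x t
  have dv : ∀ n t x, HasDerivAt (fun x' => v n x' t) (u n x t) x := fun n t x => by
    rw [hu]; exact hasDerivAt_fst (hvS n) x t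
  have du : ∀ n t x, HasDerivAt (fun x' => u n x' t) (p n x t) x := fun n t x => by
    rw [hp]; exact hasDerivAt_fst (huS n) x t
  have dp : ∀ n t x, HasDerivAt (fun x' => p n x' t) (q n x t) x := fun n t x => by
    rw [hq]; exact hasDerivAt_fst (hpS n) x t
  have dq : ∀ n t x, HasDerivAt (fun x' => q n x' t) (r n x t) x := fun n t x => by
    rw [hr]; exact hasDerivAt_fst (hqS n) x t
  have hexp : ∀ n x t, f n x t = Real.exp (Real.log (f n x t)) := fun n x t =>
    (Real.exp_log (hfpos n x t)).symm
  have evol_v : ∀ n x t,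
      deriv (fun t' => v n x t') t = (1/4) * q n x t + (3/2) * (u n x t)^2 := by
    intro n x t
    have key := heq1 n x t
    rw [hirota3_one_one_self_exp (hexp n) (hL n) x t, deriv_fst_deriv_snd_comm (hL n),
      hirota3_four_self_exp (fun y => hexp n y t) (dL n t) (dv n t) (du n t) (dp n t)] at key
    simp only [← hv] at key
    refine mul_left_cancel₀ (pow_ne_zero 2 (hfpos n x t).ne') ?_
    linear_combination key / 2
  intro n x t
  have bilinear : ∀ y, u (n + h/2) y t + u (n - h/2) y t =
      (2/h) * (v (n + h/2) y t - v (n - h/2) y t)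
        - (v (n + h/2) y t - v (n - h/2) y t) ^ 2 := by
    intro y
    have key := heq2 (n + h/2) y t
    have shift : n + h/2 - h = n - h/2 := by ring
    have hirota := hirota3_zero_shift_exp (A := f) (B := fun n' x' t' => f (n' - h) x' t')
      (n := n + h/2) (x := y) (t := t) (b := fun x' => Real.log (f (n - h/2) x' t))
      (fun z => hexp _ z t) (fun z => by rw [shift]; exact hexp _ z t)
      (dL _ t) (dv _ t) (dL _ t) (dv _ t)
    rw [hirota.1, hirota.2] at key
    refine mul_left_cancel₀
      (mul_pos (hfpos (n + h/2) y t) (hfpos (n + h/2 - h) y t)).ne' ?_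
    linear_combination key
  have eq_p : ∀ y, p (n + h/2) y t + p (n - h/2) y t =
      (2/h) * (u (n + h/2) y t - u (n - h/2) y t)
        - 2 * (u (n + h/2) y t - u (n - h/2) y t)
            * (v (n + h/2) y t - v (n - h/2) y t) := by
    intro y
    have lhs := (du (n + h/2) t y).fun_add (du (n - h/2) t y)
    have dvd := (dv (n + h/2) t y).fun_sub (dv (n - h/2) t y)
    rw [funext bilinear] at lhs
    rw [lhs.unique ((dvd.const_mul (2/h)).fun_sub (dvd.fun_pow 2))]
    norm_num
    ring
  have eq_q : ∀ y, q (n + h/2) y t + q (n - h/2) y t =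
      (2/h) * (p (n + h/2) y t - p (n - h/2) y t)
        - 2 * (p (n + h/2) y t - p (n - h/2) y t)
            * (v (n + h/2) y t - v (n - h/2) y t)
        - 2 * (u (n + h/2) y t - u (n - h/2) y t)^2 := by
    intro y
    have lhs := (dp (n + h/2) t y).fun_add (dp (n - h/2) t y)
    have dvd := (dv (n + h/2) t y).fun_sub (dv (n - h/2) t y)
    have dud := (du (n + h/2) t y).fun_sub (du (n - h/2) t y)
    rw [funext eq_p] at lhs
    rw [lhs.unique ((dud.const_mul (2/h)).fun_sub ((dud.const_mul 2).fun_mul dvd))]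
    ring
  have eq_r : r (n + h/2) x t + r (n - h/2) x t =
      (2/h) * (q (n + h/2) x t - q (n - h/2) x t)
        - 6 * (p (n + h/2) x t - p (n - h/2) x t)
            * (u (n + h/2) x t - u (n - h/2) x t)
        - 2 * (q (n + h/2) x t - q (n - h/2) x t)
            * (v (n + h/2) x t - v (n - h/2) x t) := by
    have lhs := (dq (n + h/2) t x).fun_add (dq (n - h/2) t x)
    have dvd := (dv (n + h/2) t x).fun_sub (dv (n - h/2) t x)
    have dud := (du (n + h/2) t x).fun_sub (du (n - h/2) t x)
    have dpd := (dp (n + h/2) t x).fun_sub (dp (n - h/2) t x)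
    rw [funext eq_q] at lhs
    rw [lhs.unique (((dpd.const_mul (2/h)).fun_sub ((dpd.const_mul 2).fun_mul dvd)).fun_sub
      ((dud.fun_pow 2).const_mul 2))]
    norm_num
    ring
  refine ⟨?_, evol_v n x t, eq_p x, eq_q x, eq_r⟩
  simp only [hu]
  rw [← deriv_fst_deriv_snd_comm (hvS n)]
  simp only [evol_v, ← hu]
  rw [(((dq n t x).const_mul (1/4)).fun_add (((du n t x).fun_pow 2).const_mul (3/2))).deriv]
  norm_num
  ring
end

section
/- (Bäcklund transformation for the semi-discrete KdV system.) Let h > 0, β, γ ∈ ℝ, and let f, g : ℝ³ → ℝ be smooth functions of (n, x, t) with f nowhere zero. Suppose f satisfies D_x(D_t − (1/4)D_x³) f·f = 0 and (D_x² − (2/h)D_x) f_n·f_{n−h} = 0 at every point, and suppose g satisfies at every point: (i) (D_x e^{−(h/2)D_n}) f·g = −(1/h)(e^{−(h/2)D_n} f·g) + β (e^{(h/2)D_n} f·g); (ii) D_x² f·g = γ f g; (iii) (D_t − (1/4)D_x³ − (3γ/4)D_x) f·g = 0. Then g satisfies D_x(D_t − (1/4)D_x³) g·g = 0 and (D_x²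 − (2/h)D_x) g_n·g_{n−h} = 0 at every point. -/
/-- The `x`-Hirota derivative of order `a` of two functions of one variable, expanded. -/
theorem iteratedDeriv_add_mul_sub {p q : ℝ → ℝ} (hp : ContDiff ℝ (⊤ : ℕ∞) p)
    (hq : ContDiff ℝ (⊤ : ℕ∞) q) (a : ℕ) (x : ℝ) :
    iteratedDeriv a (fun r => p (x + r) * q (x - r)) 0 =
      ∑ i ∈ Finset.range (a + 1), (a.choose i : ℝ) * iteratedDeriv i p x *
        ((-1) ^ (a - i) * iteratedDeriv (a - i) q x) := by
  have h1 : ContDiff ℝ (⊤ : ℕ∞) (fun r => p (x + r)) := by fun_prop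
  have h2 : ContDiff ℝ (⊤ : ℕ∞) (fun r => q (x - r)) := by fun_prop
  have := iteratedDeriv_fun_mul (n := a) (x := (0 : ℝ))
    (h1.contDiffAt.of_le (by exact_mod_cast le_top)) (h2.contDiffAt.of_le (by exact_mod_cast le_top))
  simpa [iteratedDeriv_comp_const_add, iteratedDeriv_comp_const_sub] using this

theorem deriv_add_mul_sub {p q : ℝ → ℝ} (hp : ContDiff ℝ (⊤ : ℕ∞) p)
    (hq : ContDiff ℝ (⊤ : ℕ∞) q) (x : ℝ) :
    deriv (fun r => p (x + r) * q (x - r)) 0 = deriv p x * q x - p x * deriv q x := by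
  have := iteratedDeriv_add_mul_sub hp hq 1 x
  simp [Finset.sum_range_succ] at this
  linarith

theorem hasDerivAt_iteratedDeriv {p : ℝ → ℝ} (hp : ContDiff ℝ (⊤ : ℕ∞) p) (k : ℕ) (x : ℝ) :
    HasDerivAt (iteratedDeriv k p) (iteratedDeriv (k + 1) p x) x := by
  rw [iteratedDeriv_succ]
  exact (hp.differentiable_iteratedDeriv k (by exact_mod_cast ENat.natCast_lt_top k) x).hasDerivAt

theorem contDiff_x_slice {f : ℝ → ℝ → ℝ → ℝ}
    (hf : ContDiff ℝ (⊤ : ℕ∞) (fun pt : ℝ × ℝ × ℝ => f pt.1 pt.2.1 pt.2.2)) (n t : ℝ) :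
    ContDiff ℝ (⊤ : ℕ∞) (fun x => f n x t) :=
  hf.comp (g := fun pt : ℝ × ℝ × ℝ => f pt.1 pt.2.1 pt.2.2) (f := fun x : ℝ => (n, x, t))
    (by fun_prop)

theorem contDiff_t_slice {f : ℝ → ℝ → ℝ → ℝ}
    (hf : ContDiff ℝ (⊤ : ℕ∞) (fun pt : ℝ × ℝ × ℝ => f pt.1 pt.2.1 pt.2.2)) (n x : ℝ) :
    ContDiff ℝ (⊤ : ℕ∞) (fun t => f n x t) :=
  hf.comp (g := fun pt : ℝ × ℝ × ℝ => f pt.1 pt.2.1 pt.2.2) (f := fun t : ℝ => (n, x, t))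
    (by fun_prop)

theorem contDiff_deriv_t_slice {f : ℝ → ℝ → ℝ → ℝ}
    (hf : ContDiff ℝ (⊤ : ℕ∞) (fun pt : ℝ × ℝ × ℝ => f pt.1 pt.2.1 pt.2.2)) (n t : ℝ) :
    ContDiff ℝ (⊤ : ℕ∞) (fun x => deriv (fun t => f n x t) t) := by
  have heq : (fun x => deriv (fun t => f n x t) t) = fun x =>
      fderiv ℝ (fun pt : ℝ × ℝ × ℝ => f pt.1 pt.2.1 pt.2.2) (n, x, t) (0, 0, 1) := by
    funext x
    have hd : HasDerivAt (fun t : ℝ => (n, x, t)) (0, 0, 1) t :=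
      (hasDerivAt_const t n).prodMk ((hasDerivAt_const t x).prodMk (hasDerivAt_id t))
    exact (((hf.differentiable (by simp)) (n, x, t)).hasFDerivAt.comp_hasDerivAt t hd).deriv
  rw [heq]
  have hF := hf.fderiv_right (m := ((⊤ : ℕ∞) : WithTop ℕ∞)) (by simp)
  exact (hF.comp (f := fun x : ℝ => (n, x, t)) (by fun_prop)).clm_apply contDiff_const

theorem hirota3_x {A B : ℝ → ℝ → ℝ → ℝ}
    (hA : ∀ n t, ContDiff ℝ (⊤ : ℕ∞) (fun x => A n x t))
    (hB : ∀ n t, ContDiff ℝ (⊤ : ℕ∞) (fun x => B n x t)) (a : ℕ) (δ n x t : ℝ) :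
    hirota3 a 0 δ A B n x t =
      ∑ i ∈ Finset.range (a + 1), (a.choose i : ℝ) * iteratedDeriv i (fun x => A (n + δ) x t) x *
        ((-1) ^ (a - i) * iteratedDeriv (a - i) (fun x => B (n - δ) x t) x) := by
  simpa [hirota3] using iteratedDeriv_add_mul_sub (hA (n + δ) t) (hB (n - δ) t) a x

theorem hirota3_t {A B : ℝ → ℝ → ℝ → ℝ}
    (hA : ∀ n x, ContDiff ℝ (⊤ : ℕ∞) (fun t => A n x t))
    (hB : ∀ n x, ContDiff ℝ (⊤ : ℕ∞) (fun t => B n x t)) (δ n x t : ℝ) :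
    hirota3 0 1 δ A B n x t =
      deriv (fun t => A (n + δ) x t) t * B (n - δ) x t
        - A (n + δ) x t * deriv (fun t => B (n - δ) x t) t := by
  simpa [hirota3] using deriv_add_mul_sub (hA (n + δ) x) (hB (n - δ) x) t

theorem hirota3_xt {A B : ℝ → ℝ → ℝ → ℝ}
    (hA : ∀ n x, ContDiff ℝ (⊤ : ℕ∞) (fun t => A n x t))
    (hB : ∀ n x, ContDiff ℝ (⊤ : ℕ∞) (fun t => B n x t))
    (hAx : ∀ n t, ContDiff ℝ (⊤ : ℕ∞) (fun x => A n x t))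
    (hBx : ∀ n t, ContDiff ℝ (⊤ : ℕ∞) (fun x => B n x t))
    (hAt : ∀ n t, ContDiff ℝ (⊤ : ℕ∞) (fun x => deriv (fun t => A n x t) t))
    (hBt : ∀ n t, ContDiff ℝ (⊤ : ℕ∞) (fun x => deriv (fun t => B n x t) t)) (δ n x t : ℝ) :
    hirota3 1 1 δ A B n x t =
      (deriv (fun x => deriv (fun t => A (n + δ) x t) t) x * B (n - δ) x t
        - deriv (fun t => A (n + δ) x t) t * deriv (fun x => B (n - δ) x t) x)
      - (deriv (fun x => A (n + δ) x t) x * deriv (fun t => B (n - δ) x t) t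
        - A (n + δ) x t * deriv (fun x => deriv (fun t => B (n - δ) x t) t) x) := by
  have hw (r : ℝ) := deriv_add_mul_sub (hA (n + δ) (x + r)) (hB (n - δ) (x - r)) t
  simp only [hirota3, iteratedDeriv_one, hw]
  have h1 := (hAt (n + δ) t).differentiable (by simp)
  have h2 := (hBx (n - δ) t).differentiable (by simp)
  have h3 := (hAx (n + δ) t).differentiable (by simp)
  have h4 := (hBt (n - δ) t).differentiable (by simp)
  rw [deriv_fun_sub, deriv_add_mul_sub (hAt (n + δ) t) (hBx (n - δ) t),
    deriv_add_mul_sub (hAx (n + δ) t) (hBt (n - δ) t)]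
  · exact ((h1.comp (differentiable_id.const_add x)).mul
      (h2.comp (differentiable_id.const_sub x))) 0
  · exact ((h3.comp (differentiable_id.const_add x)).mul
      (h4.comp (differentiable_id.const_sub x))) 0

/-- If `p`, `q` are related by the bilinear Bäcklund transformation of KdV, then the bilinear
KdV equation passes from `p` to `q`. Here `pt`, `qt` play the role of the `t`-derivatives. -/
theorem kdv_transfer {p q pt qt : ℝ → ℝ} (hp : ContDiff ℝ (⊤ : ℕ∞) p)
    (hq : ContDiff ℝ (⊤ : ℕ∞) q) (hpt : ContDiff ℝ (⊤ : ℕ∞) pt) (hqt : ContDiff ℝ (⊤ : ℕ∞) qt)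
    {γ x : ℝ} (hne : p x ≠ 0)
    (hK : 2 * (deriv pt x * p x - pt x * deriv p x) - 1 / 2 * (iteratedDeriv 4 p x * p x
      - 4 * iteratedDeriv 3 p x * deriv p x + 3 * iteratedDeriv 2 p x ^ 2) = 0)
    (hS : ∀ x, iteratedDeriv 2 p x * q x - 2 * deriv p x * deriv q x
      + p x * iteratedDeriv 2 q x = γ * (p x * q x))
    (hT : ∀ x, pt x * q x - p x * qt x - 1 / 4 * (iteratedDeriv 3 p x * q x
      - 3 * iteratedDeriv 2 p x * deriv q x + 3 * deriv p x * iteratedDeriv 2 q x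
      - p x * iteratedDeriv 3 q x) - 3 * γ / 4 * (deriv p x * q x - p x * deriv q x) = 0) :
    2 * (deriv qt x * q x - qt x * deriv q x) - 1 / 2 * (iteratedDeriv 4 q x * q x
      - 4 * iteratedDeriv 3 q x * deriv q x + 3 * iteratedDeriv 2 q x ^ 2) = 0 := by
  have p0 := hasDerivAt_iteratedDeriv hp 0 x
  have p1 := hasDerivAt_iteratedDeriv hp 1 x
  have p2 := hasDerivAt_iteratedDeriv hp 2 x
  have p3 := hasDerivAt_iteratedDeriv hp 3 x
  have q0 := hasDerivAt_iteratedDeriv hq 0 x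
  have q1 := hasDerivAt_iteratedDeriv hq 1 x
  have q2 := hasDerivAt_iteratedDeriv hq 2 x
  have q3 := hasDerivAt_iteratedDeriv hq 3 x
  have s0 := hasDerivAt_iteratedDeriv hpt 0 x
  have r0 := hasDerivAt_iteratedDeriv hqt 0 x
  simp only [zero_add, Nat.reduceAdd, iteratedDeriv_zero, iteratedDeriv_one]
    at p0 p1 p2 p3 q0 q1 q2 q3 s0 r0
  have hS' := ((((p2.mul q0).sub ((p1.const_mul 2).mul q1)).add (p0.mul q2)).sub
    ((p0.mul q0).const_mul γ)).unique
    ((hasDerivAt_const x (0 : ℝ)).congr_of_eventuallyEq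
      (Filter.Eventually.of_forall fun y => sub_eq_zero.2 (hS y)))
  have hT' := ((((s0.mul q0).sub (p0.mul r0)).sub
    (((((p3.mul q0).sub ((p2.const_mul 3).mul q1)).add ((p1.const_mul 3).mul q2)).sub
      (p0.mul q3)).const_mul (1 / 4))).sub
    (((p1.mul q0).sub (p0.mul q1)).const_mul (3 * γ / 4))).unique
    ((hasDerivAt_const x (0 : ℝ)).congr_of_eventuallyEq (Filter.Eventually.of_forall hT))
  refine (mul_eq_zero.1 ?_).resolve_left (pow_ne_zero 2 hne)
  linear_combination q x ^ 2 * hK - 2 * (p x * q x) * hT'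
    + 2 * (deriv p x * q x + p x * deriv q x) * hT x
    + 3 / 2 * (deriv q x * p x - q x * deriv p x) * hS'
    - 3 / 2 * (iteratedDeriv 2 q x * p x - q x * iteratedDeriv 2 p x) * hS x

/-- If `(p, q)` and `(p', q')`, the values at `n` and `n - h`, are related by the bilinear
Bäcklund transformation, then the lattice equation passes from `(p, p')` to `(q, q')`. -/
theorem lattice_transfer {p p' q q' : ℝ → ℝ} (hp : ContDiff ℝ (⊤ : ℕ∞) p)
    (hp' : ContDiff ℝ (⊤ : ℕ∞) p') (hq : ContDiff ℝ (⊤ : ℕ∞) q) (hq' : ContDiff ℝ (⊤ : ℕ∞) q')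
    {γ β κ x : ℝ} (hne : p x ≠ 0) (hne' : p' x ≠ 0)
    (hQ : iteratedDeriv 2 p x * p' x - 2 * deriv p x * deriv p' x + p x * iteratedDeriv 2 p' x
      - 2 * κ * (deriv p x * p' x - p x * deriv p' x) = 0)
    (hS : iteratedDeriv 2 p x * q x - 2 * deriv p x * deriv q x
      + p x * iteratedDeriv 2 q x = γ * (p x * q x))
    (hS' : iteratedDeriv 2 p' x * q' x - 2 * deriv p' x * deriv q' x
      + p' x * iteratedDeriv 2 q' x = γ * (p' x * q' x))
    (hW : ∀ x, deriv p' x * q x - p' x * deriv q x + κ * (p' x * q x)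
      - β * (p x * q' x) = 0) :
    iteratedDeriv 2 q x * q' x - 2 * deriv q x * deriv q' x + q x * iteratedDeriv 2 q' x
      - 2 * κ * (deriv q x * q' x - q x * deriv q' x) = 0 := by
  have p0 := hasDerivAt_iteratedDeriv hp 0 x
  have u0 := hasDerivAt_iteratedDeriv hp' 0 x
  have u1 := hasDerivAt_iteratedDeriv hp' 1 x
  have q0 := hasDerivAt_iteratedDeriv hq 0 x
  have q1 := hasDerivAt_iteratedDeriv hq 1 x
  have v0 := hasDerivAt_iteratedDeriv hq' 0 x
  simp only [zero_add, Nat.reduceAdd, iteratedDeriv_zero, iteratedDeriv_one]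
    at p0 u0 u1 q0 q1 v0
  have hW' := ((((u1.mul q0).sub (u0.mul q1)).add ((u0.mul q0).const_mul κ)).sub
    ((p0.mul v0).const_mul β)).unique
    ((hasDerivAt_const x (0 : ℝ)).congr_of_eventuallyEq (Filter.Eventually.of_forall hW))
  refine (mul_eq_zero.1 ?_).resolve_left (mul_ne_zero hne hne')
  linear_combination q x * q' x * hQ - 2 * (p x * q' x) * hW'
    + 2 * (deriv p x * q' x + p x * deriv q' x) * hW x
    - p' x * q' x * hS + p x * q x * hS'

/-- Proposition 1: Bäcklund transformation for the semi-discrete KdV system. -/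
theorem semidiscrete_KdV_Backlund
    (h : ℝ) (hh : 0 < h) (β γ : ℝ) (f g : ℝ → ℝ → ℝ → ℝ)
    (hf : ContDiff ℝ (⊤ : ℕ∞) (fun pt : ℝ × ℝ × ℝ => f pt.1 pt.2.1 pt.2.2))
    (hg : ContDiff ℝ (⊤ : ℕ∞) (fun pt : ℝ × ℝ × ℝ => g pt.1 pt.2.1 pt.2.2))
    (hfne : ∀ n x t, f n x t ≠ 0)
    (hfeq1 : ∀ n x t,
      hirota3 1 1 0 f f n x t - (1/4) * hirota3 4 0 0 f f n x t = 0)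
    (hfeq2 : ∀ n x t,
      hirota3 2 0 0 f (fun n' x' t' => f (n' - h) x' t') n x t
        - (2/h) * hirota3 1 0 0 f (fun n' x' t' => f (n' - h) x' t') n x t = 0)
    (hbt1 : ∀ n x t,
      hirota3 1 0 (-(h/2)) f g n x t =
        -(1/h) * hirota3 0 0 (-(h/2)) f g n x t + β * hirota3 0 0 (h/2) f g n x t)
    (hbt2 : ∀ n x t,
      hirota3 2 0 0 f g n x t = γ * (f n x t * g n x t))
    (hbt3 : ∀ n x t,
      hirota3 0 1 0 f g n x t - (1/4) * hirota3 3 0 0 f g n x t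
        - (3*γ/4) * hirota3 1 0 0 f g n x t = 0) :
    (∀ n x t,
      hirota3 1 1 0 g g n x t - (1/4) * hirota3 4 0 0 g g n x t = 0) ∧
    (∀ n x t,
      hirota3 2 0 0 g (fun n' x' t' => g (n' - h) x' t') n x t
        - (2/h) * hirota3 1 0 0 g (fun n' x' t' => g (n' - h) x' t') n x t = 0) := by
  have hfx (n t) := contDiff_x_slice hf n t
  have hgx (n t) := contDiff_x_slice hg n t
  have hft (n x) := contDiff_t_slice hf n x
  have hgt (n x) := contDiff_t_slice hg n x
  have hftx (n t) := contDiff_deriv_t_slice hf n t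
  have hgtx (n t) := contDiff_deriv_t_slice hg n t
  have hfxh (n t) : ContDiff ℝ (⊤ : ℕ∞) (fun x => (fun n' x' t' => f (n' - h) x' t') n x t) :=
    hfx (n - h) t
  have hgxh (n t) : ContDiff ℝ (⊤ : ℕ∞) (fun x => (fun n' x' t' => g (n' - h) x' t') n x t) :=
    hgx (n - h) t
  have hx2 (n x t) : iteratedDeriv 2 (fun x => f n x t) x * g n x t
      - 2 * deriv (fun x => f n x t) x * deriv (fun x => g n x t) x
      + f n x t * iteratedDeriv 2 (fun x => g n x t) x = γ * (f n x t * g n x t) := by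
    have := hbt2 n x t
    rw [hirota3_x hfx hgx] at this
    simp [Finset.sum_range_succ] at this
    linarith
  constructor
  · intro n x t
    have hK := hfeq1 n x t
    rw [hirota3_xt hft hft hfx hfx hftx hftx, hirota3_x hfx hfx] at hK
    rw [hirota3_xt hgt hgt hgx hgx hgtx hgtx, hirota3_x hgx hgx]
    have hT (x : ℝ) := hbt3 n x t
    simp only [hirota3_t hft hgt, hirota3_x hfx hgx] at hT
    simp [Finset.sum_range_succ, Nat.choose] at hK hT ⊢
    have key := kdv_transfer (hfx n t) (hgx n t) (hftx n t) (hgtx n t) (γ := γ) (x := x)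
      (hfne n x t) (by linear_combination hK) (fun x => hx2 n x t)
      (fun x => by linear_combination hT x)
    linear_combination key
  · intro n x t
    have hQ := hfeq2 n x t
    rw [hirota3_x hfx hfxh, hirota3_x hfx hfxh] at hQ
    rw [hirota3_x hgx hgxh, hirota3_x hgx hgxh]
    have hW (x : ℝ) := hbt1 (n - h / 2) x t
    simp only [hirota3_x hfx hgx, show n - h / 2 + -(h / 2) = n - h by ring,
      show n - h / 2 - -(h / 2) = n by ring, show n - h / 2 + h / 2 = n by ring,
      show n - h / 2 - h / 2 = n - h by ring] at hW
    simp [Finset.sum_range_succ] at hQ hW ⊢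
    have key := lattice_transfer (hfx n t) (hfx (n - h) t) (hgx n t) (hgx (n - h) t)
      (γ := γ) (β := β) (κ := 1 / h) (x := x) (hfne n x t) (hfne (n - h) x t)
      (by linear_combination hQ) (hx2 n x t) (hx2 (n - h) x t)
      (fun x => by linear_combination hW x)
    linear_combination key
end

section
/- (Bäcklund transformation for the semi-discrete KP system.) Let h > 0, β, γ ∈ ℝ, and let f, g : ℝ⁴ → ℝ be smooth functions of (n, x, y, t) with f nowhere zero. Suppose f satisfies (D_x⁴ − 4D_xD_t + 3D_y²) f·f = 0, (D_y − D_x² + (2/h)D_x) f_n·f_{n−h} = 0 and (3D_yD_x − 4D_t + D_x³ − (6/h)D_y) f_n·f_{n−h} = 0 at every point, and suppose g satisfies at every point: (i) (D_x e^{−(h/2)D_n}) f·g = −(1/h)(e^{−(h/2)D_n} f·g) + β (e^{(h/2)D_n} f·g); (ii) (D_y − D_x²) f·g = γ f g; (iii) (3D_yD_x − 4D_t + D_x³ − 3γ D_x) f·g = 0. Then g satisfies (D_x⁴ − 4D_xD_t + 3D_y²) g·g = 0, (D_y − D_x² + (2/h)D_x) g_n·g_{n−h} = 0 and (3D_yD_x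 − 4D_t + D_x³ − (6/h)D_y) g_n·g_{n−h} = 0 at every point. -/
/-- Hirota bilinear operator `D_x^a D_y^b D_t^c e^{δ D_n}` applied to a pair of
functions of `(n, x, y, t)`, evaluated at `(n, x, y, t)`. -/
noncomputable def hirota4 (a b c : ℕ) (δ : ℝ) (A B : ℝ → ℝ → ℝ → ℝ → ℝ) (n x y t : ℝ) : ℝ :=
  iteratedDeriv a (fun r =>
    iteratedDeriv b (fun s =>
      iteratedDeriv c (fun w =>
        A (n + δ) (x + r) (y + s) (t + w) * B (n - δ) (x - r) (y - s) (t - w)) 0) 0) 0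

/-- The composite of the Hirota derivatives attached to the derivations in a list, applied to the
bilinear pairing `μ`. -/
def hirotaList {R T : Type*} [CommRing R] [Algebra ℝ R] [AddCommGroup T] (μ : R → R → T) :
    List (Derivation ℝ R R) → R → R → T
  | [], A, B => μ A B
  | d :: L, A, B => hirotaList μ L (d A) B - hirotaList μ L A (d B)

section Algebra

variable {R : Type*} [CommRing R] [Algebra ℝ R]

theorem derivation_ofNat (d : Derivation ℝ R R) (m : ℕ) [m.AtLeastTwo] :
    d ofNat(m) = 0 :=
  d.map_natCast m

/-- Bilinear exchange identity behind the KP equation. -/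
theorem kp_exchange (dx dy dt : Derivation ℝ R R)
    (hxy : ∀ a, dy (dx a) = dx (dy a)) (γ : ℝ) (F G : R)
    (h2 : hirotaList (· * ·) [dy] F G - hirotaList (· * ·) [dx, dx] F G = γ • (F * G))
    (h3 : 3 * hirotaList (· * ·) [dy, dx] F G - 4 * hirotaList (· * ·) [dt] F G
      + hirotaList (· * ·) [dx, dx, dx] F G - (3 * γ) • hirotaList (· * ·) [dx] F G = 0) :
    F * F * (hirotaList (· * ·) [dx, dx, dx, dx] G G - 4 * hirotaList (· * ·) [dt, dx] G G
      + 3 * hirotaList (· * ·) [dy, dy] G G)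
    = G * G * (hirotaList (· * ·) [dx, dx, dx, dx] F F - 4 * hirotaList (· * ·) [dt, dx] F F
      + 3 * hirotaList (· * ·) [dy, dy] F F) := by
  simp only [hirotaList, Algebra.smul_def, map_mul] at *
  have h2x := congrArg dx h2
  have h2y := congrArg dy h2
  have h3x := congrArg dx h3
  simp only [map_add, map_sub, map_zero, Derivation.leibniz, Derivation.map_algebraMap, derivation_ofNat,
    smul_eq_mul, hxy, map_ofNat] at *
  linear_combination (-2 * F * G) * h3x + (6 * F * dx G - 6 * dx F * G) * h2x
    + (2 * dx F * G + 2 * F * dx G) * h3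
    + (6 * dx (dx F) * G + 6 * F * dy G - 6 * F * dx (dx G) + 6 * dy F * G) * h2
    - 6 * F * G * h2y

/-- Bilinear exchange identity for the first semi-discrete equation. -/
theorem semidiscrete_exchange_two (dx dy : Derivation ℝ R R) (k β γ : ℝ) (F f G g : R)
    (h1 : hirotaList (· * ·) [dx] f G = -(k • (f * G)) + β • (F * g))
    (hF2 : hirotaList (· * ·) [dy] F G - hirotaList (· * ·) [dx, dx] F G = γ • (F * G))
    (hf2 : hirotaList (· * ·) [dy] f g - hirotaList (· * ·) [dx, dx] f g = γ • (f * g)) :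
    F * f * (hirotaList (· * ·) [dy] G g - hirotaList (· * ·) [dx, dx] G g
      + (2 * k) • hirotaList (· * ·) [dx] G g)
    = G * g * (hirotaList (· * ·) [dy] F f - hirotaList (· * ·) [dx, dx] F f
      + (2 * k) • hirotaList (· * ·) [dx] F f) := by
  simp only [hirotaList, Algebra.smul_def, map_mul] at *
  have h1x := congrArg dx h1
  simp only [map_add, map_sub, map_neg, Derivation.leibniz, Derivation.map_algebraMap,
    smul_eq_mul, map_ofNat] at *
  linear_combination F * G * hf2 - (2 * F * dx g + 2 * dx F * g) * h1 + 2 * F * g * h1x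
    - f * g * hF2

/-- Bilinear exchange identity for the second semi-discrete equation. -/
theorem semidiscrete_exchange_three (dx dy dt : Derivation ℝ R R)
    (hxy : ∀ a, dy (dx a) = dx (dy a)) (k β γ : ℝ) (F f G g : R)
    (h1 : hirotaList (· * ·) [dx] f G = -(k • (f * G)) + β • (F * g))
    (hF2 : hirotaList (· * ·) [dy] F G - hirotaList (· * ·) [dx, dx] F G = γ • (F * G))
    (hf2 : hirotaList (· * ·) [dy] f g - hirotaList (· * ·) [dx, dx] f g = γ • (f * g))
    (hF3 : 3 * hirotaList (· * ·) [dy, dx] F G - 4 * hirotaList (· * ·) [dt] F G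
      + hirotaList (· * ·) [dx, dx, dx] F G - (3 * γ) • hirotaList (· * ·) [dx] F G = 0)
    (hf3 : 3 * hirotaList (· * ·) [dy, dx] f g - 4 * hirotaList (· * ·) [dt] f g
      + hirotaList (· * ·) [dx, dx, dx] f g - (3 * γ) • hirotaList (· * ·) [dx] f g = 0)
    (hQF : hirotaList (· * ·) [dy] F f - hirotaList (· * ·) [dx, dx] F f
      + (2 * k) • hirotaList (· * ·) [dx] F f = 0)
    (hQG : hirotaList (· * ·) [dy] G g - hirotaList (· * ·) [dx, dx] G g
      + (2 * k) • hirotaList (· * ·) [dx] G g = 0) :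
    F * f * (3 * hirotaList (· * ·) [dy, dx] G g - 4 * hirotaList (· * ·) [dt] G g
      + hirotaList (· * ·) [dx, dx, dx] G g - (6 * k) • hirotaList (· * ·) [dy] G g)
    = G * g * (3 * hirotaList (· * ·) [dy, dx] F f - 4 * hirotaList (· * ·) [dt] F f
      + hirotaList (· * ·) [dx, dx, dx] F f - (6 * k) • hirotaList (· * ·) [dy] F f) := by
  simp only [hirotaList, Algebra.smul_def, map_mul] at *
  have h1x := congrArg dx h1
  have h1xx := congrArg dx h1x
  have h1y := congrArg dy h1
  have hf2x := congrArg dx hf2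
  have hQGx := congrArg dx hQG
  simp only [map_add, map_sub, map_neg, map_zero, Derivation.leibniz, Derivation.map_algebraMap,
    derivation_ofNat, smul_eq_mul, hxy, map_ofNat] at *
  linear_combination (3 * F * dy g + 6 * dx F * dx g + 3 * F * dx (dx g) + 3 * dy F * g
      + 3 * dx (dx F) * g) * h1
    + 3 * F * f * hQGx + (3 * F * dx f - 3 * dx F * f) * hQG + F * G * hf3 - 3 * F * G * hf2x
    - 3 * F * g * h1y - 3 * F * g * h1xx
    + (-3 * F * G * algebraMap ℝ R k - 3 * F * dx G + 3 * dx F * G) * hf2 - 6 * G * dx g * hQF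
    + (6 * f * dx g + 3 * f * g * algebraMap ℝ R k) * hF2 - f * g * hF3

end Algebra

/-- The algebra of smooth real functions on a normed space. -/
def smoothAlgebra (E : Type*) [NormedAddCommGroup E] [NormedSpace ℝ E] :
    Subalgebra ℝ (E → ℝ) where
  carrier := {F | ContDiff ℝ (⊤ : ℕ∞) F}
  mul_mem' {F G} (hF : ContDiff ℝ _ F) (hG : ContDiff ℝ _ G) :=
    show ContDiff ℝ (⊤ : ℕ∞) (F * G) from hF.mul hG
  add_mem' {F G} (hF : ContDiff ℝ _ F) (hG : ContDiff ℝ _ G) :=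
    show ContDiff ℝ (⊤ : ℕ∞) (F + G) from hF.add hG
  algebraMap_mem' c := (contDiff_const : ContDiff ℝ (⊤ : ℕ∞) fun _ : E => c)

section Smooth

variable {E : Type*} [NormedAddCommGroup E] [NormedSpace ℝ E]

theorem smoothAlgebra_differentiableAt (A : smoothAlgebra E) (p : E) :
    DifferentiableAt ℝ A.1 p :=
  (show ContDiff ℝ (⊤ : ℕ∞) A.1 from A.2).differentiable (by simp) p

/-- The directional derivative as a derivation of the algebra of smooth functions. -/
noncomputable def directionalDeriv (v : E) :
    Derivation ℝ (smoothAlgebra E) (smoothAlgebra E) :=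
  Derivation.mk'
    { toFun := fun A => ⟨fun p => fderiv ℝ A.1 p v,
        (show ContDiff ℝ (⊤ : ℕ∞) A.1 from A.2).fderiv_right (m := (⊤ : ℕ∞)) le_rfl
          |>.clm_apply contDiff_const⟩
      map_add' := fun A B => by
        ext p
        change fderiv ℝ (A.1 + B.1) p v = fderiv ℝ A.1 p v + fderiv ℝ B.1 p v
        rw [fderiv_add (smoothAlgebra_differentiableAt A p) (smoothAlgebra_differentiableAt B p)]
        rfl
      map_smul' := fun c A => by
        ext p
        change fderiv ℝ (c • A.1) p v = c * fderiv ℝ A.1 p v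
        rw [fderiv_const_smul (smoothAlgebra_differentiableAt A p)]
        rfl }
    (fun A B => by
      ext p
      change fderiv ℝ (A.1 * B.1) p v = A.1 p * fderiv ℝ B.1 p v + B.1 p * fderiv ℝ A.1 p v
      rw [fderiv_mul (smoothAlgebra_differentiableAt A p) (smoothAlgebra_differentiableAt B p)]
      rfl)

theorem directionalDeriv_comm (v w : E) (A : smoothAlgebra E) :
    directionalDeriv v (directionalDeriv w A) = directionalDeriv w (directionalDeriv v A) := by
  have hA : ContDiff ℝ (⊤ : ℕ∞) A.1 := A.2
  have hd : Differentiable ℝ (fderiv ℝ A.1) :=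
    (hA.fderiv_right (m := (⊤ : ℕ∞)) le_rfl).differentiable (by simp)
  ext p
  change fderiv ℝ (fun q => fderiv ℝ A.1 q w) p v = fderiv ℝ (fun q => fderiv ℝ A.1 q v) p w
  have key : ∀ u z, fderiv ℝ (fun q => fderiv ℝ A.1 q u) p z
      = fderiv ℝ (fderiv ℝ A.1) p z u := fun u z => by
    rw [fderiv_clm_apply (hd p) (differentiableAt_const u)]
    simp
  rw [key, key]
  exact (hA.contDiffAt.isSymmSndFDerivAt
    (by simpa using WithTop.coe_le_coe.2 (le_top : (2 : ℕ∞) ≤ ⊤))).eq v w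

theorem smoothAlgebra_hasDerivAt_line (A : smoothAlgebra E) (p v : E) (r : ℝ) :
    HasDerivAt (fun r : ℝ => A.1 (p + r • v)) ((directionalDeriv v A).1 (p + r • v)) r := by
  have hl : HasDerivAt (fun r : ℝ => p + r • v) v r := by
    simpa using ((hasDerivAt_id r).smul_const v).const_add p
  exact (smoothAlgebra_differentiableAt A _).hasFDerivAt.comp_hasDerivAt r hl

theorem directionalDeriv_neg (v : E) (A : smoothAlgebra E) :
    directionalDeriv (-v) A = -directionalDeriv v A := by
  ext p
  exact (fderiv ℝ A.1 p).map_neg v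

theorem hirotaList_hasDerivAt (L : List (Derivation ℝ (smoothAlgebra E) (smoothAlgebra E)))
    (A B : smoothAlgebra E) (p q v : E) (r : ℝ) :
    HasDerivAt
      (fun r : ℝ => hirotaList (fun A B => A.1 (p + r • v) * B.1 (q - r • v)) L A B)
      (hirotaList (fun A B => A.1 (p + r • v) * B.1 (q - r • v))
        (L ++ [directionalDeriv v]) A B) r := by
  induction L generalizing A B with
  | nil =>
    have hB := smoothAlgebra_hasDerivAt_line B q (-v) r
    rw [directionalDeriv_neg] at hB
    simp only [smul_neg, ← sub_eq_add_neg] at hB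
    refine ((smoothAlgebra_hasDerivAt_line A p v r).mul hB).congr_deriv ?_
    change _ * _ + _ * (-((directionalDeriv v B).1 _)) = _ * _ - _ * _
    ring
  | cons d L ih => exact (ih (d A) B).sub (ih A (d B))

theorem iteratedDeriv_hirotaList
    (L : List (Derivation ℝ (smoothAlgebra E) (smoothAlgebra E))) (A B : smoothAlgebra E)
    (p q v : E) (k : ℕ) :
    iteratedDeriv k
      (fun r : ℝ => hirotaList (fun A B => A.1 (p + r • v) * B.1 (q - r • v)) L A B)
    = fun r : ℝ => hirotaList (fun A B => A.1 (p + r • v) * B.1 (q - r • v))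
        (L ++ List.replicate k (directionalDeriv v)) A B := by
  induction k with
  | zero => simp
  | succ k ih =>
    rw [iteratedDeriv_succ, ih]
    ext r
    rw [(hirotaList_hasDerivAt _ A B p q v r).deriv, List.replicate_succ', List.append_assoc]

theorem hirotaList_mul_apply (L : List (Derivation ℝ (smoothAlgebra E) (smoothAlgebra E)))
    (A B : smoothAlgebra E) (p : E) :
    hirotaList (fun A B => A.1 p * B.1 p) L A B = (hirotaList (· * ·) L A B).1 p := by
  induction L generalizing A B with
  | nil => rfl
  | cons d L ih => exact congrArg₂ (· - ·) (ih (d A) B) (ih A (d B))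

end Smooth

/-- The partial derivative in `x`. -/
noncomputable def partialX := directionalDeriv ((0, 1, 0, 0) : ℝ × ℝ × ℝ × ℝ)

/-- The partial derivative in `y`. -/
noncomputable def partialY := directionalDeriv ((0, 0, 1, 0) : ℝ × ℝ × ℝ × ℝ)

/-- The partial derivative in `t`. -/
noncomputable def partialT := directionalDeriv ((0, 0, 0, 1) : ℝ × ℝ × ℝ × ℝ)

theorem hirota4_zero_eq_hirotaList (a b c : ℕ) (A B : smoothAlgebra (ℝ × ℝ × ℝ × ℝ))
    (n x y t : ℝ) :
    hirota4 a b c 0 (fun n x y t => A.1 (n, x, y, t)) (fun n x y t => B.1 (n, x, y, t)) n x y t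
    = (hirotaList (· * ·) (List.replicate c partialT ++ List.replicate b partialY
        ++ List.replicate a partialX) A B).1 (n, x, y, t) := by
  have ht : ∀ r s : ℝ, iteratedDeriv c (fun w => A.1 (n, x + r, y + s, t + w)
      * B.1 (n, x - r, y - s, t - w)) 0
      = hirotaList (fun A B => A.1 (n, x + r, y + s, t) * B.1 (n, x - r, y - s, t))
        (List.replicate c partialT) A B := fun r s => by
    simpa [hirotaList, partialT] using congrFun (iteratedDeriv_hirotaList [] A B
      (n, x + r, y + s, t) (n, x - r, y - s, t) (0, 0, 0, 1) c) 0
  have hy : ∀ r : ℝ, iteratedDeriv b (fun s =>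
      hirotaList (fun A B => A.1 (n, x + r, y + s, t) * B.1 (n, x - r, y - s, t))
        (List.replicate c partialT) A B) 0
      = hirotaList (fun A B => A.1 (n, x + r, y, t) * B.1 (n, x - r, y, t))
        (List.replicate c partialT ++ List.replicate b partialY) A B := fun r => by
    simpa [partialY] using congrFun (iteratedDeriv_hirotaList (List.replicate c partialT) A B
      (n, x + r, y, t) (n, x - r, y, t) (0, 0, 1, 0) b) 0
  rw [← hirotaList_mul_apply]
  simp only [hirota4, add_zero, sub_zero, ht, hy]
  simpa [partialX] using congrFun (iteratedDeriv_hirotaList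
    (List.replicate c partialT ++ List.replicate b partialY) A B
      (n, x, y, t) (n, x, y, t) (0, 1, 0, 0) a) 0

/-- A shift `δ` and a base point shifted along can be absorbed into the two functions. -/
theorem hirota4_shift (a b c : ℕ) (δ m : ℝ) (A B : ℝ → ℝ → ℝ → ℝ → ℝ) (n x y t : ℝ) :
    hirota4 a b c δ A B (n + m) x y t
    = hirota4 a b c 0 (fun n x y t => A (n + (m + δ)) x y t)
        (fun n x y t => B (n + (m - δ)) x y t) n x y t := by
  simp only [hirota4, add_zero, sub_zero, add_assoc, add_sub_assoc]

/-- Proposition 2: Bäcklund transformation for the semi-discrete KP system. -/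
theorem semidiscrete_KP_Backlund
    (h : ℝ) (hh : 0 < h) (β γ : ℝ) (f g : ℝ → ℝ → ℝ → ℝ → ℝ)
    (hf : ContDiff ℝ (⊤ : ℕ∞) (fun pt : ℝ × ℝ × ℝ × ℝ => f pt.1 pt.2.1 pt.2.2.1 pt.2.2.2))
    (hg : ContDiff ℝ (⊤ : ℕ∞) (fun pt : ℝ × ℝ × ℝ × ℝ => g pt.1 pt.2.1 pt.2.2.1 pt.2.2.2))
    (hfne : ∀ n x y t, f n x y t ≠ 0)
    (hfeq1 : ∀ n x y t,
      hirota4 4 0 0 0 f f n x y t - 4 * hirota4 1 0 1 0 f f n x y t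
        + 3 * hirota4 0 2 0 0 f f n x y t = 0)
    (hfeq2 : ∀ n x y t,
      hirota4 0 1 0 0 f (fun n' x' y' t' => f (n' - h) x' y' t') n x y t
        - hirota4 2 0 0 0 f (fun n' x' y' t' => f (n' - h) x' y' t') n x y t
        + (2/h) * hirota4 1 0 0 0 f (fun n' x' y' t' => f (n' - h) x' y' t') n x y t = 0)
    (hfeq3 : ∀ n x y t,
      3 * hirota4 1 1 0 0 f (fun n' x' y' t' => f (n' - h) x' y' t') n x y t
        - 4 * hirota4 0 0 1 0 f (fun n' x' y' t' => f (n' - h) x' y' t') n x y t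
        + hirota4 3 0 0 0 f (fun n' x' y' t' => f (n' - h) x' y' t') n x y t
        - (6/h) * hirota4 0 1 0 0 f (fun n' x' y' t' => f (n' - h) x' y' t') n x y t = 0)
    (hbt1 : ∀ n x y t,
      hirota4 1 0 0 (-(h/2)) f g n x y t =
        -(1/h) * hirota4 0 0 0 (-(h/2)) f g n x y t
          + β * hirota4 0 0 0 (h/2) f g n x y t)
    (hbt2 : ∀ n x y t,
      hirota4 0 1 0 0 f g n x y t - hirota4 2 0 0 0 f g n x y t
        = γ * (f n x y t * g n x y t))
    (hbt3 : ∀ n x y t,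
      3 * hirota4 1 1 0 0 f g n x y t - 4 * hirota4 0 0 1 0 f g n x y t
        + hirota4 3 0 0 0 f g n x y t - 3 * γ * hirota4 1 0 0 0 f g n x y t = 0) :
    (∀ n x y t,
      hirota4 4 0 0 0 g g n x y t - 4 * hirota4 1 0 1 0 g g n x y t
        + 3 * hirota4 0 2 0 0 g g n x y t = 0) ∧
    (∀ n x y t,
      hirota4 0 1 0 0 g (fun n' x' y' t' => g (n' - h) x' y' t') n x y t
        - hirota4 2 0 0 0 g (fun n' x' y' t' => g (n' - h) x' y' t') n x y t
        + (2/h) * hirota4 1 0 0 0 g (fun n' x' y' t' => g (n' - h) x' y' t') n x y t = 0) ∧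
    (∀ n x y t,
      3 * hirota4 1 1 0 0 g (fun n' x' y' t' => g (n' - h) x' y' t') n x y t
        - 4 * hirota4 0 0 1 0 g (fun n' x' y' t' => g (n' - h) x' y' t') n x y t
        + hirota4 3 0 0 0 g (fun n' x' y' t' => g (n' - h) x' y' t') n x y t
        - (6/h) * hirota4 0 1 0 0 g (fun n' x' y' t' => g (n' - h) x' y' t') n x y t = 0) := by
  have hf' : ContDiff ℝ (⊤ : ℕ∞)
      (fun pt : ℝ × ℝ × ℝ × ℝ => f (pt.1 - h) pt.2.1 pt.2.2.1 pt.2.2.2) :=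
    hf.comp (g := fun pt : ℝ × ℝ × ℝ × ℝ => f pt.1 pt.2.1 pt.2.2.1 pt.2.2.2)
      (f := fun pt : ℝ × ℝ × ℝ × ℝ => (pt.1 - h, pt.2)) (by fun_prop)
  have hg' : ContDiff ℝ (⊤ : ℕ∞)
      (fun pt : ℝ × ℝ × ℝ × ℝ => g (pt.1 - h) pt.2.1 pt.2.2.1 pt.2.2.2) :=
    hg.comp (g := fun pt : ℝ × ℝ × ℝ × ℝ => g pt.1 pt.2.1 pt.2.2.1 pt.2.2.2)
      (f := fun pt : ℝ × ℝ × ℝ × ℝ => (pt.1 - h, pt.2)) (by fun_prop)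
  let F : smoothAlgebra (ℝ × ℝ × ℝ × ℝ) := ⟨_, hf⟩
  let F' : smoothAlgebra (ℝ × ℝ × ℝ × ℝ) := ⟨_, hf'⟩
  let G : smoothAlgebra (ℝ × ℝ × ℝ × ℝ) := ⟨_, hg⟩
  let G' : smoothAlgebra (ℝ × ℝ × ℝ × ℝ) := ⟨_, hg'⟩
  have eFF := fun a b c => hirota4_zero_eq_hirotaList a b c F F
  have eFF' := fun a b c => hirota4_zero_eq_hirotaList a b c F F'
  have eFG := fun a b c => hirota4_zero_eq_hirotaList a b c F G
  have eGG := fun a b c => hirota4_zero_eq_hirotaList a b c G G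
  have eGG' := fun a b c => hirota4_zero_eq_hirotaList a b c G G'
  have eF'G' : ∀ a b c n x y t, hirota4 a b c 0 f g (n - h) x y t
      = (hirotaList (· * ·) (List.replicate c partialT ++ List.replicate b partialY
        ++ List.replicate a partialX) F' G').1 (n, x, y, t) := fun a b c n x y t => by
    rw [← hirota4_zero_eq_hirotaList, sub_eq_add_neg, hirota4_shift]
    simp [F', G', sub_eq_add_neg]
  have eF'G : ∀ a b c n x y t, hirota4 a b c (-(h/2)) f g (n - h / 2) x y t
      = (hirotaList (· * ·) (List.replicate c partialT ++ List.replicate b partialY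
        ++ List.replicate a partialX) F' G).1 (n, x, y, t) := fun a b c n x y t => by
    rw [← hirota4_zero_eq_hirotaList, sub_eq_add_neg n, hirota4_shift]
    have e1 : -(h / 2) + -(h / 2) = -h := by ring
    simp [F', G, sub_eq_add_neg, e1]
  have eFG' : ∀ a b c n x y t, hirota4 a b c (h/2) f g (n - h / 2) x y t
      = (hirotaList (· * ·) (List.replicate c partialT ++ List.replicate b partialY
        ++ List.replicate a partialX) F G').1 (n, x, y, t) := fun a b c n x y t => by
    rw [← hirota4_zero_eq_hirotaList, sub_eq_add_neg n, hirota4_shift]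
    have e1 : -(h / 2) - (h / 2) = -h := by ring
    simp [F, G', sub_eq_add_neg, ← e1]
  dsimp only [F, F', G, G'] at eFF eFF' eFG eGG eGG'
  simp only [eFF, eFF', eFG, eGG, eGG'] at *
  have b1 := fun n x y t => hbt1 (n - h / 2) x y t
  have b2 := fun n x y t => hbt2 (n - h) x y t
  have b3 := fun n x y t => hbt3 (n - h) x y t
  simp only [eF'G', eF'G, eFG'] at b1 b2 b3 hbt2 hbt3
  simp only [List.replicate, List.nil_append, List.cons_append] at *
  have xy := directionalDeriv_comm (0, 0, 1, 0) ((0, 1, 0, 0) : ℝ × ℝ × ℝ × ℝ)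
  have r1 : hirotaList (· * ·) [partialX] F' G = -((1 / h) • (F' * G)) + β • (F * G') := by
    ext ⟨n, x, y, t⟩
    exact (b1 n x y t).trans (congrArg (· + _) (neg_mul _ _))
  have r2 : hirotaList (· * ·) [partialY] F G - hirotaList (· * ·) [partialX, partialX] F G
      = γ • (F * G) := by
    ext ⟨n, x, y, t⟩
    exact hbt2 n x y t
  have r2' : hirotaList (· * ·) [partialY] F' G'
      - hirotaList (· * ·) [partialX, partialX] F' G' = γ • (F' * G') := by
    ext ⟨n, x, y, t⟩
    exact b2 n x y t
  have r3 : 3 * hirotaList (· * ·) [partialY, partialX] F G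
      - 4 * hirotaList (· * ·) [partialT] F G
      + hirotaList (· * ·) [partialX, partialX, partialX] F G
      - (3 * γ) • hirotaList (· * ·) [partialX] F G = 0 := by
    ext ⟨n, x, y, t⟩
    exact hbt3 n x y t
  have r3' : 3 * hirotaList (· * ·) [partialY, partialX] F' G'
      - 4 * hirotaList (· * ·) [partialT] F' G'
      + hirotaList (· * ·) [partialX, partialX, partialX] F' G'
      - (3 * γ) • hirotaList (· * ·) [partialX] F' G' = 0 := by
    ext ⟨n, x, y, t⟩
    exact b3 n x y t
  have q2 : hirotaList (· * ·) [partialY] F F' - hirotaList (· * ·) [partialX, partialX] F F'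
      + (2 * (1 / h)) • hirotaList (· * ·) [partialX] F F' = 0 := by
    ext ⟨n, x, y, t⟩
    rw [mul_one_div]
    exact hfeq2 n x y t
  have cancel : ∀ A B : smoothAlgebra (ℝ × ℝ × ℝ × ℝ), (∀ p, A.1 p ≠ 0) → A * B = 0 → B = 0 := by
    intro A B hA hAB
    ext p
    exact (mul_eq_zero.1 (congrFun (congrArg Subtype.val hAB) p)).resolve_left (hA p)
  have nFF : ∀ p, (F * F).1 p ≠ 0 := fun p => mul_ne_zero (hfne _ _ _ _) (hfne _ _ _ _)
  have nFF' : ∀ p, (F * F').1 p ≠ 0 := fun p => mul_ne_zero (hfne _ _ _ _) (hfne _ _ _ _)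
  have g2 := cancel _ _ nFF' <|
    (semidiscrete_exchange_two partialX partialY (1 / h) β γ F F' G G' r1 r2 r2').trans
      (by rw [q2, mul_zero])
  refine ⟨fun n x y t => ?_, fun n x y t => ?_, fun n x y t => ?_⟩
  · refine congrFun (congrArg Subtype.val (cancel _ _ nFF <|
      (kp_exchange partialX partialY partialT xy γ F G r2 r3).trans ?_)) (n, x, y, t)
    rw [mul_eq_zero_of_right]
    ext ⟨n, x, y, t⟩
    exact hfeq1 n x y t
  · rw [mul_one_div] at g2
    exact congrFun (congrArg Subtype.val g2) (n, x, y, t)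
  · have g3 := cancel _ _ nFF' <|
      (semidiscrete_exchange_three partialX partialY partialT xy (1 / h) β γ F F' G G'
        r1 r2 r2' r3 r3' q2 g2).trans (mul_eq_zero_of_right _ (by
          ext ⟨n, x, y, t⟩
          rw [mul_one_div]
          exact hfeq3 n x y t))
    rw [mul_one_div] at g3
    exact congrFun (congrArg Subtype.val g3) (n, x, y, t)
end

section
/- Let h > 0, let a ∈ ℂ satisfy a² = −3, and let f : ℝ³ → ℂ be a smooth, nowhere-vanishing function of (n, x, t) satisfying, at every point, (D_t² − D_x² − D_x⁴) f·f = 0 and (D_t − a D_x² + (2a/h)D_x) f_n·f_{n−h} = 0. Define v := (∂_x f)/f (so v = ∂_x ln f on any branch), u := ∂_x v, p := ∂_x u, q := ∂_x p, r := ∂_x q, s := ∂_x r. Then at every point (with the n-argument shifted as shown and all other arguments equal): (i) ∂_t²u − q − s − 12uq − 12p² = 0; (ii) ∂_t²v − p − r − 12up = 0; (iii) a(p(n+h) + p(n)) = (2a/h)(u(n+h) − u(n)) + (∂_t v(n+h) − ∂_t v(n)) − 2a(u(n+h) − u(n))(v(n+h) − v(n)); (iv) a(q(n+h) + q(n)) =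 (2a/h)(p(n+h) − p(n)) + (∂_t u(n+h) − ∂_t u(n)) − 2a(p(n+h) − p(n))(v(n+h) − v(n)) − 2a(u(n+h) − u(n))²; (v) a(r(n+h) + r(n)) = (2a/h)(q(n+h) − q(n)) + (∂_t p(n+h) − ∂_t p(n)) − 6a(p(n+h) − p(n))(u(n+h) − u(n)) − 2a(q(n+h) − q(n))(v(n+h) − v(n)); (vi) a(s(n+h) + s(n)) = (2a/h)(r(n+h) − r(n)) + (∂_t q(n+h) − ∂_t q(n)) − 6a(p(n+h) − p(n))² − 8a(q(n+h) − q(n))(u(n+h) − u(n)) − 2a(r(n+h) − r(n))(v(n+h) − v(n)). -/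
/-- Hirota bilinear operator `D_x^a D_t^c e^{δ D_n}` applied to a pair of ℂ-valued
functions of `(n, x, t)`, evaluated at `(n, x, t)`. -/
noncomputable def hirotaC (a c : ℕ) (δ : ℝ) (A B : ℝ → ℝ → ℝ → ℂ) (n x t : ℝ) : ℂ :=
  iteratedDeriv a (fun r =>
    iteratedDeriv c (fun w => A (n + δ) (x + r) (t + w) * B (n - δ) (x - r) (t - w)) 0) 0

/-- The partial derivative in the first variable. -/
noncomputable def derivFst (F : ℝ → ℝ → ℂ) (x t : ℝ) : ℂ := deriv (fun x' => F x' t) x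

/-- The partial derivative in the second variable. -/
noncomputable def derivSnd (F : ℝ → ℝ → ℂ) (x t : ℝ) : ℂ := deriv (fun t' => F x t') t

/-- Joint smoothness of a curried function of two real variables. -/
def Smooth₂ (F : ℝ → ℝ → ℂ) : Prop := ContDiff ℝ (⊤ : ℕ∞) (fun z : ℝ × ℝ => F z.1 z.2)

namespace Smooth₂

variable {F G : ℝ → ℝ → ℂ}

theorem hasDerivAt_fst_fderiv (hF : Smooth₂ F) (x t : ℝ) :
    HasDerivAt (fun x' => F x' t) (fderiv ℝ (fun z : ℝ × ℝ => F z.1 z.2) (x, t) (1, 0)) x := by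
  have hd := (hF.differentiable (by simp) (x, t)).hasFDerivAt
  exact hd.comp_hasDerivAt x ((hasDerivAt_id x).prodMk (hasDerivAt_const x t))

theorem hasDerivAt_snd_fderiv (hF : Smooth₂ F) (x t : ℝ) :
    HasDerivAt (fun t' => F x t') (fderiv ℝ (fun z : ℝ × ℝ => F z.1 z.2) (x, t) (0, 1)) t := by
  have hd := (hF.differentiable (by simp) (x, t)).hasFDerivAt
  exact hd.comp_hasDerivAt t ((hasDerivAt_const t x).prodMk (hasDerivAt_id t))

theorem derivFst_eq (hF : Smooth₂ F) (x t : ℝ) :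
    derivFst F x t = fderiv ℝ (fun z : ℝ × ℝ => F z.1 z.2) (x, t) (1, 0) :=
  (hF.hasDerivAt_fst_fderiv x t).deriv

theorem derivSnd_eq (hF : Smooth₂ F) (x t : ℝ) :
    derivSnd F x t = fderiv ℝ (fun z : ℝ × ℝ => F z.1 z.2) (x, t) (0, 1) :=
  (hF.hasDerivAt_snd_fderiv x t).deriv

theorem hasDerivAt_fst (hF : Smooth₂ F) (x t : ℝ) :
    HasDerivAt (fun x' => F x' t) (derivFst F x t) x :=
  hF.derivFst_eq x t ▸ hF.hasDerivAt_fst_fderiv x t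

theorem hasDerivAt_snd (hF : Smooth₂ F) (x t : ℝ) :
    HasDerivAt (fun t' => F x t') (derivSnd F x t) t :=
  hF.derivSnd_eq x t ▸ hF.hasDerivAt_snd_fderiv x t

theorem contDiff_fderiv_apply (hF : Smooth₂ F) (w : ℝ × ℝ) :
    ContDiff ℝ (⊤ : ℕ∞) (fun z => fderiv ℝ (fun z : ℝ × ℝ => F z.1 z.2) z w) :=
  (hF.fderiv_right (by simp)).clm_apply contDiff_const

theorem derivFst (hF : Smooth₂ F) : Smooth₂ (derivFst F) := by
  have : _root_.derivFst F =
      fun x t => fderiv ℝ (fun z : ℝ × ℝ => F z.1 z.2) (x, t) (1, 0) := by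
    ext x t; exact hF.derivFst_eq x t
  rw [this]
  exact hF.contDiff_fderiv_apply (1, 0)

theorem derivSnd (hF : Smooth₂ F) : Smooth₂ (derivSnd F) := by
  have : _root_.derivSnd F =
      fun x t => fderiv ℝ (fun z : ℝ × ℝ => F z.1 z.2) (x, t) (0, 1) := by
    ext x t; exact hF.derivSnd_eq x t
  rw [this]
  exact hF.contDiff_fderiv_apply (0, 1)

theorem div (hF : Smooth₂ F) (hG : Smooth₂ G) (hG0 : ∀ x t, G x t ≠ 0) :
    Smooth₂ (fun x t => F x t / G x t) := by
  simp only [Smooth₂, div_eq_mul_inv]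
  exact ContDiff.mul hF (ContDiff.inv hG fun z => hG0 z.1 z.2)

/-- Mixed partial derivatives commute. -/
theorem derivFst_derivSnd (hF : Smooth₂ F) (x t : ℝ) :
    _root_.derivFst (_root_.derivSnd F) x t = _root_.derivSnd (_root_.derivFst F) x t := by
  set F' : ℝ × ℝ → ℂ := fun z => F z.1 z.2 with hF'
  have hFF : ContDiff ℝ (⊤ : ℕ∞) F' := hF
  have hd : HasFDerivAt (fderiv ℝ F') (fderiv ℝ (fderiv ℝ F') (x, t)) (x, t) :=
    ((hFF.fderiv_right (m := (⊤ : ℕ∞)) (by simp)).differentiable (by simp) (x, t)).hasFDerivAt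
  have h1 : HasDerivAt (fun x' => fderiv ℝ F' (x', t) (0, 1))
      (fderiv ℝ (fderiv ℝ F') (x, t) (1, 0) (0, 1)) x := by
    have := hd.comp_hasDerivAt x ((hasDerivAt_id x).prodMk (hasDerivAt_const x t))
    simpa using this.clm_apply (hasDerivAt_const x ((0, 1) : ℝ × ℝ))
  have h2 : HasDerivAt (fun t' => fderiv ℝ F' (x, t') (1, 0))
      (fderiv ℝ (fderiv ℝ F') (x, t) (0, 1) (1, 0)) t := by
    have := hd.comp_hasDerivAt t ((hasDerivAt_const t x).prodMk (hasDerivAt_id t))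
    simpa using this.clm_apply (hasDerivAt_const t ((1, 0) : ℝ × ℝ))
  have e1 : _root_.derivFst (_root_.derivSnd F) x t =
      fderiv ℝ (fderiv ℝ F') (x, t) (1, 0) (0, 1) := by
    rw [← h1.deriv]
    simp only [_root_.derivFst, hF.derivSnd_eq, hF']
  have e2 : _root_.derivSnd (_root_.derivFst F) x t =
      fderiv ℝ (fderiv ℝ F') (x, t) (0, 1) (1, 0) := by
    rw [← h2.deriv]
    simp only [_root_.derivSnd, hF.derivFst_eq, hF']
  rw [e1, e2]
  have hsymm : IsSymmSndFDerivAt ℝ F' (x, t) :=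
    hFF.contDiffAt.isSymmSndFDerivAt (by
      rw [minSmoothness_of_isRCLikeNormedField]; exact WithTop.coe_le_coe.2 le_top)
  exact hsymm (1, 0) (0, 1)

end Smooth₂

section Hirota

variable {A A₁ A₂ A₃ A₄ B B₁ B₂ B₃ B₄ : ℝ → ℂ}

theorem hasDerivAt_mul_reflect (hA : ∀ x, HasDerivAt A (A₁ x) x)
    (hB : ∀ x, HasDerivAt B (B₁ x) x) (x r : ℝ) :
    HasDerivAt (fun r => A (x + r) * B (x - r))
      (A₁ (x + r) * B (x - r) - A (x + r) * B₁ (x - r)) r := by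
  have h1 : HasDerivAt (fun r => A (x + r)) (A₁ (x + r)) r := (hA (x + r)).comp_const_add x r
  have h2 : HasDerivAt (fun r => B (x - r)) (-B₁ (x - r)) r := (hB (x - r)).comp_const_sub x r
  exact (h1.mul h2).congr_deriv (by ring)

theorem iteratedDeriv_one_mul_reflect (hA : ∀ x, HasDerivAt A (A₁ x) x)
    (hB : ∀ x, HasDerivAt B (B₁ x) x) (x : ℝ) :
    iteratedDeriv 1 (fun r => A (x + r) * B (x - r)) 0 = A₁ x * B x - A x * B₁ x := by
  rw [iteratedDeriv_one, (hasDerivAt_mul_reflect hA hB x 0).deriv]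
  simp

theorem deriv_deriv_mul_reflect
    (hA : ∀ x, HasDerivAt A (A₁ x) x) (hA₁ : ∀ x, HasDerivAt A₁ (A₂ x) x)
    (hB : ∀ x, HasDerivAt B (B₁ x) x) (hB₁ : ∀ x, HasDerivAt B₁ (B₂ x) x) (x : ℝ) :
    deriv (deriv fun r => A (x + r) * B (x - r)) = fun r =>
      A₂ (x + r) * B (x - r) - 2 * (A₁ (x + r) * B₁ (x - r)) + A (x + r) * B₂ (x - r) := by
  have h1 : deriv (fun r => A (x + r) * B (x - r)) = fun r =>
      A₁ (x + r) * B (x - r) - A (x + r) * B₁ (x - r) :=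
    funext fun r => (hasDerivAt_mul_reflect hA hB x r).deriv
  rw [h1]
  funext r
  rw [((hasDerivAt_mul_reflect hA₁ hB x r).fun_sub (hasDerivAt_mul_reflect hA hB₁ x r)).deriv]
  ring

theorem iteratedDeriv_two_mul_reflect
    (hA : ∀ x, HasDerivAt A (A₁ x) x) (hA₁ : ∀ x, HasDerivAt A₁ (A₂ x) x)
    (hB : ∀ x, HasDerivAt B (B₁ x) x) (hB₁ : ∀ x, HasDerivAt B₁ (B₂ x) x) (x : ℝ) :
    iteratedDeriv 2 (fun r => A (x + r) * B (x - r)) 0 =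
      A₂ x * B x - 2 * (A₁ x * B₁ x) + A x * B₂ x := by
  rw [iteratedDeriv_succ, iteratedDeriv_one, deriv_deriv_mul_reflect hA hA₁ hB hB₁]
  simp

theorem iteratedDeriv_four_mul_reflect
    (hA : ∀ x, HasDerivAt A (A₁ x) x) (hA₁ : ∀ x, HasDerivAt A₁ (A₂ x) x)
    (hA₂ : ∀ x, HasDerivAt A₂ (A₃ x) x) (hA₃ : ∀ x, HasDerivAt A₃ (A₄ x) x)
    (hB : ∀ x, HasDerivAt B (B₁ x) x) (hB₁ : ∀ x, HasDerivAt B₁ (B₂ x) x)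
    (hB₂ : ∀ x, HasDerivAt B₂ (B₃ x) x) (hB₃ : ∀ x, HasDerivAt B₃ (B₄ x) x) (x : ℝ) :
    iteratedDeriv 4 (fun r => A (x + r) * B (x - r)) 0 =
      A₄ x * B x - 4 * (A₃ x * B₁ x) + 6 * (A₂ x * B₂ x) - 4 * (A₁ x * B₃ x) + A x * B₄ x := by
  have h3 : deriv (fun r => A₂ (x + r) * B (x - r) - 2 * (A₁ (x + r) * B₁ (x - r))
      + A (x + r) * B₂ (x - r)) = fun r => A₃ (x + r) * B (x - r) - 3 * (A₂ (x + r) * B₁ (x - r))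
      + 3 * (A₁ (x + r) * B₂ (x - r)) - A (x + r) * B₃ (x - r) := by
    funext r
    rw [(((hasDerivAt_mul_reflect hA₂ hB x r).fun_sub
      ((hasDerivAt_mul_reflect hA₁ hB₁ x r).const_mul 2)).fun_add
      (hasDerivAt_mul_reflect hA hB₂ x r)).deriv]
    ring
  rw [iteratedDeriv_succ, iteratedDeriv_succ, iteratedDeriv_succ, iteratedDeriv_one,
    deriv_deriv_mul_reflect hA hA₁ hB hB₁, h3,
    ((((hasDerivAt_mul_reflect hA₃ hB x 0).fun_sub
      ((hasDerivAt_mul_reflect hA₂ hB₁ x 0).const_mul 3)).fun_add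
      ((hasDerivAt_mul_reflect hA₁ hB₂ x 0).const_mul 3)).fun_sub
      (hasDerivAt_mul_reflect hA hB₃ x 0)).deriv]
  simp only [add_zero, sub_zero]
  ring

end Hirota

/-- Theorem 3 (nonlinear form of the semi-discrete Boussinesq system). -/
theorem semidiscrete_Boussinesq_nonlinear_form
    (h : ℝ) (hh : 0 < h) (a : ℂ) (ha : a^2 = -3) (f : ℝ → ℝ → ℝ → ℂ)
    (hf : ContDiff ℝ (⊤ : ℕ∞) (fun pt : ℝ × ℝ × ℝ => f pt.1 pt.2.1 pt.2.2))
    (hfne : ∀ n x t, f n x t ≠ 0)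
    (heq1 : ∀ n x t,
      hirotaC 0 2 0 f f n x t - hirotaC 2 0 0 f f n x t
        - hirotaC 4 0 0 f f n x t = 0)
    (heq2 : ∀ n x t,
      hirotaC 0 1 0 f (fun n' x' t' => f (n' - h) x' t') n x t
        - a * hirotaC 2 0 0 f (fun n' x' t' => f (n' - h) x' t') n x t
        + (2 * a / (h : ℂ)) * hirotaC 1 0 0 f (fun n' x' t' => f (n' - h) x' t') n x t = 0)
    (v u p q r s : ℝ → ℝ → ℝ → ℂ)
    (hv : ∀ n x t, v n x t = deriv (fun x' => f n x' t) x / f n x t)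
    (hu : ∀ n x t, u n x t = deriv (fun x' => v n x' t) x)
    (hp : ∀ n x t, p n x t = deriv (fun x' => u n x' t) x)
    (hq : ∀ n x t, q n x t = deriv (fun x' => p n x' t) x)
    (hr : ∀ n x t, r n x t = deriv (fun x' => q n x' t) x)
    (hs : ∀ n x t, s n x t = deriv (fun x' => r n x' t) x) :
    ∀ n x t,
      (deriv (fun t' => deriv (fun t'' => u n x t'') t') t
        - q n x t - s n x t - 12 * u n x t * q n x t - 12 * (p n x t)^2 = 0) ∧
      (deriv (fun t' => deriv (fun t'' => v n x t'') t') t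
        - p n x t - r n x t - 12 * u n x t * p n x t = 0) ∧
      (a * (p (n + h) x t + p n x t) =
        (2 * a / (h : ℂ)) * (u (n + h) x t - u n x t)
          + (deriv (fun t' => v (n + h) x t') t - deriv (fun t' => v n x t') t)
          - 2 * a * (u (n + h) x t - u n x t) * (v (n + h) x t - v n x t)) ∧
      (a * (q (n + h) x t + q n x t) =
        (2 * a / (h : ℂ)) * (p (n + h) x t - p n x t)
          + (deriv (fun t' => u (n + h) x t') t - deriv (fun t' => u n x t') t)
          - 2 * a * (p (n + h) x t - p n x t) * (v (n + h) x t - v n x t)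
          - 2 * a * (u (n + h) x t - u n x t)^2) ∧
      (a * (r (n + h) x t + r n x t) =
        (2 * a / (h : ℂ)) * (q (n + h) x t - q n x t)
          + (deriv (fun t' => p (n + h) x t') t - deriv (fun t' => p n x t') t)
          - 6 * a * (p (n + h) x t - p n x t) * (u (n + h) x t - u n x t)
          - 2 * a * (q (n + h) x t - q n x t) * (v (n + h) x t - v n x t)) ∧
      (a * (s (n + h) x t + s n x t) =
        (2 * a / (h : ℂ)) * (r (n + h) x t - r n x t)
          + (deriv (fun t' => q (n + h) x t') t - deriv (fun t' => q n x t') t)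
          - 6 * a * (p (n + h) x t - p n x t)^2
          - 8 * a * (q (n + h) x t - q n x t) * (u (n + h) x t - u n x t)
          - 2 * a * (r (n + h) x t - r n x t) * (v (n + h) x t - v n x t)) := by
  have hS : ∀ n, Smooth₂ (f n) := fun n =>
    hf.comp (contDiff_const.prodMk contDiff_id : ContDiff ℝ (⊤ : ℕ∞) fun z : ℝ × ℝ => (n, z))
  have hvS : ∀ n, Smooth₂ (v n) := fun n => by
    have : v n = fun x t => derivFst (f n) x t / f n x t := by ext x t; exact hv n x t
    rw [this]
    exact (hS n).derivFst.div (hS n) (hfne n)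
  have hu' : ∀ n, u n = derivFst (v n) := fun n => by ext x t; exact hu n x t
  have hp' : ∀ n, p n = derivFst (u n) := fun n => by ext x t; exact hp n x t
  have hq' : ∀ n, q n = derivFst (p n) := fun n => by ext x t; exact hq n x t
  have hr' : ∀ n, r n = derivFst (q n) := fun n => by ext x t; exact hr n x t
  have hs' : ∀ n, s n = derivFst (r n) := fun n => by ext x t; exact hs n x t
  have huS : ∀ n, Smooth₂ (u n) := fun n => hu' n ▸ (hvS n).derivFst
  have hpS : ∀ n, Smooth₂ (p n) := fun n => hp' n ▸ (huS n).derivFst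
  have hqS : ∀ n, Smooth₂ (q n) := fun n => hq' n ▸ (hpS n).derivFst
  have hrS : ∀ n, Smooth₂ (r n) := fun n => hr' n ▸ (hqS n).derivFst
  have dv : ∀ n x t, HasDerivAt (fun x' => v n x' t) (u n x t) x :=
    fun n x t => by rw [hu']; exact (hvS n).hasDerivAt_fst x t
  have du : ∀ n x t, HasDerivAt (fun x' => u n x' t) (p n x t) x :=
    fun n x t => by rw [hp']; exact (huS n).hasDerivAt_fst x t
  have dp : ∀ n x t, HasDerivAt (fun x' => p n x' t) (q n x t) x :=
    fun n x t => by rw [hq']; exact (hpS n).hasDerivAt_fst x t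
  have dq : ∀ n x t, HasDerivAt (fun x' => q n x' t) (r n x t) x :=
    fun n x t => by rw [hr']; exact (hqS n).hasDerivAt_fst x t
  have dr : ∀ n x t, HasDerivAt (fun x' => r n x' t) (s n x t) x :=
    fun n x t => by rw [hs']; exact (hrS n).hasDerivAt_fst x t
  have df : ∀ n x t, HasDerivAt (fun x' => f n x' t) (v n x t * f n x t) x := fun n x t => by
    rw [hv, div_mul_cancel₀ _ (hfne n x t)]
    exact (hS n).hasDerivAt_fst x t
  have df1 : ∀ n x t, HasDerivAt (fun x' => v n x' t * f n x' t)
      ((u n x t + v n x t ^ 2) * f n x t) x := fun n x t =>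
    ((dv n x t).fun_mul (df n x t)).congr_deriv (by ring)
  have df2 : ∀ n x t, HasDerivAt (fun x' => (u n x' t + v n x' t ^ 2) * f n x' t)
      ((p n x t + 3 * u n x t * v n x t + v n x t ^ 3) * f n x t) x := fun n x t =>
    (((du n x t).fun_add ((dv n x t).fun_pow 2)).fun_mul (df n x t)).congr_deriv
      (by push_cast; ring)
  have df3 : ∀ n x t, HasDerivAt
      (fun x' => (p n x' t + 3 * u n x' t * v n x' t + v n x' t ^ 3) * f n x' t)
      ((q n x t + 4 * p n x t * v n x t + 3 * u n x t ^ 2 + 6 * u n x t * v n x t ^ 2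
        + v n x t ^ 4) * f n x t) x := fun n x t =>
    ((((dp n x t).fun_add (((du n x t).const_mul 3).fun_mul (dv n x t))).fun_add
      ((dv n x t).fun_pow 3)).fun_mul (df n x t)).congr_deriv (by push_cast; ring)
  -- `w` is the `t`-derivative of `ln f`.
  obtain ⟨w, hw⟩ : ∃ w : ℝ → ℝ → ℝ → ℂ, ∀ n, w n = fun x t => derivSnd (f n) x t / f n x t :=
    ⟨_, fun _ => rfl⟩
  have hwS : ∀ n, Smooth₂ (w n) := fun n => by
    rw [hw]; exact (hS n).derivSnd.div (hS n) (hfne n)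
  have dft : ∀ n x t, HasDerivAt (fun t' => f n x t') (w n x t * f n x t) t := fun n x t => by
    rw [hw, div_mul_cancel₀ _ (hfne n x t)]
    exact (hS n).hasDerivAt_snd x t
  have dft1 : ∀ n x t, HasDerivAt (fun t' => w n x t' * f n x t')
      ((derivSnd (w n) x t + w n x t ^ 2) * f n x t) t := fun n x t =>
    (((hwS n).hasDerivAt_snd x t).fun_mul (dft n x t)).congr_deriv (by ring)
  have wx : ∀ n, derivFst (w n) = derivSnd (v n) := fun n => by
    ext x t
    have h0 := (hS n).derivFst_derivSnd x t
    have e1 : derivSnd (f n) = fun x t => w n x t * f n x t := by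
      ext x t; exact (dft n x t).deriv
    have e2 : derivFst (f n) = fun x t => v n x t * f n x t := by
      ext x t; exact (df n x t).deriv
    rw [e1, e2] at h0
    have h1 := (((hwS n).hasDerivAt_fst x t).fun_mul (df n x t)).deriv
    have h2 := (((hvS n).hasDerivAt_snd x t).fun_mul (dft n x t)).deriv
    have h3 : derivFst (w n) x t * f n x t + w n x t * (v n x t * f n x t) =
        derivSnd (v n) x t * f n x t + v n x t * (w n x t * f n x t) := h1.symm.trans (h0.trans h2)
    exact mul_right_cancel₀ (hfne n x t) (by linear_combination h3)
  have log1 : ∀ n x t, derivSnd (w n) x t = u n x t + q n x t + 6 * u n x t ^ 2 := fun n x t => by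
    have h0 := heq1 n x t
    simp only [hirotaC, iteratedDeriv_zero, add_zero, sub_zero] at h0
    rw [iteratedDeriv_two_mul_reflect (dft n x) (dft1 n x) (dft n x) (dft1 n x),
      iteratedDeriv_two_mul_reflect (df n · t) (df1 n · t) (df n · t) (df1 n · t),
      iteratedDeriv_four_mul_reflect (df n · t) (df1 n · t) (df2 n · t) (df3 n · t)
        (df n · t) (df1 n · t) (df2 n · t) (df3 n · t)] at h0
    have h2 : 2 * f n x t ^ 2 ≠ 0 := mul_ne_zero two_ne_zero (pow_ne_zero 2 (hfne n x t))
    exact mul_left_cancel₀ h2 (by linear_combination h0)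
  have vtt : ∀ n x t, derivSnd (derivSnd (v n)) x t =
      p n x t + r n x t + 12 * u n x t * p n x t := fun n x t => by
    rw [← wx, ← (hwS n).derivFst_derivSnd]
    have e : derivSnd (w n) = fun x t => u n x t + q n x t + 6 * u n x t ^ 2 := by
      ext x t; exact log1 n x t
    rw [e]
    refine (((du n x t).fun_add (dq n x t)).fun_add
      (((du n x t).fun_pow 2).const_mul 6)).deriv.trans ?_
    push_cast; ring
  have ut : ∀ n, derivFst (derivSnd (v n)) = derivSnd (u n) := fun n => by
    ext x t; rw [(hvS n).derivFst_derivSnd, hu']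
  have pt : ∀ n, derivFst (derivSnd (u n)) = derivSnd (p n) := fun n => by
    ext x t; rw [(huS n).derivFst_derivSnd, hp']
  have qt : ∀ n, derivFst (derivSnd (p n)) = derivSnd (q n) := fun n => by
    ext x t; rw [(hpS n).derivFst_derivSnd, hq']
  have utt : ∀ n x t, derivSnd (derivSnd (u n)) x t =
      q n x t + s n x t + 12 * u n x t * q n x t + 12 * p n x t ^ 2 := fun n x t => by
    rw [← ut, ← (hvS n).derivSnd.derivFst_derivSnd]
    have e : derivSnd (derivSnd (v n)) =
        fun x t => p n x t + r n x t + 12 * u n x t * p n x t := by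
      ext x t; exact vtt n x t
    rw [e]
    refine (((dp n x t).fun_add (dr n x t)).fun_add
      (((du n x t).const_mul 12).fun_mul (dp n x t))).deriv.trans ?_
    ring
  have log2 : ∀ n x t, a * (u (n + h) x t + u n x t) =
      2 * a / (h : ℂ) * (v (n + h) x t - v n x t) + (w (n + h) x t - w n x t)
        - a * (v (n + h) x t - v n x t) ^ 2 := fun n x t => by
    have h0 := heq2 (n + h) x t
    simp only [hirotaC, iteratedDeriv_zero, add_zero, sub_zero, add_sub_cancel_right] at h0
    rw [iteratedDeriv_one_mul_reflect (dft (n + h) x) (dft n x),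
      iteratedDeriv_two_mul_reflect (df (n + h) · t) (df1 (n + h) · t) (df n · t) (df1 n · t),
      iteratedDeriv_one_mul_reflect (df (n + h) · t) (df n · t)] at h0
    have h2 : f (n + h) x t * f n x t ≠ 0 := mul_ne_zero (hfne _ x t) (hfne n x t)
    exact mul_left_cancel₀ h2 (by linear_combination -h0)
  have eq3 : ∀ n x t, a * (p (n + h) x t + p n x t) =
      2 * a / (h : ℂ) * (u (n + h) x t - u n x t)
        + (derivSnd (v (n + h)) x t - derivSnd (v n) x t)
        - 2 * a * (u (n + h) x t - u n x t) * (v (n + h) x t - v n x t) := fun n x t => by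
    have hl := ((du (n + h) x t).fun_add (du n x t)).const_mul a
    have hd := (dv (n + h) x t).fun_sub (dv n x t)
    have hR := ((hd.const_mul (2 * a / (h : ℂ))).fun_add
      (((hwS (n + h)).hasDerivAt_fst x t).fun_sub ((hwS n).hasDerivAt_fst x t))).fun_sub
      ((hd.fun_pow 2).const_mul a)
    rw [funext fun x' => log2 n x' t] at hl
    rw [← wx, ← wx, hl.unique hR]
    push_cast; ring
  have eq4 : ∀ n x t, a * (q (n + h) x t + q n x t) =
      2 * a / (h : ℂ) * (p (n + h) x t - p n x t)
        + (derivSnd (u (n + h)) x t - derivSnd (u n) x t)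
        - 2 * a * (p (n + h) x t - p n x t) * (v (n + h) x t - v n x t)
        - 2 * a * (u (n + h) x t - u n x t) ^ 2 := fun n x t => by
    have hl := ((dp (n + h) x t).fun_add (dp n x t)).const_mul a
    have hd := (dv (n + h) x t).fun_sub (dv n x t)
    have hd1 := (du (n + h) x t).fun_sub (du n x t)
    have hR := ((hd1.const_mul (2 * a / (h : ℂ))).fun_add
      (((hvS (n + h)).derivSnd.hasDerivAt_fst x t).fun_sub
        ((hvS n).derivSnd.hasDerivAt_fst x t))).fun_sub ((hd1.const_mul (2 * a)).fun_mul hd)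
    rw [funext fun x' => eq3 n x' t] at hl
    rw [← ut, ← ut, hl.unique hR]
    ring
  have eq5 : ∀ n x t, a * (r (n + h) x t + r n x t) =
      2 * a / (h : ℂ) * (q (n + h) x t - q n x t)
        + (derivSnd (p (n + h)) x t - derivSnd (p n) x t)
        - 6 * a * (p (n + h) x t - p n x t) * (u (n + h) x t - u n x t)
        - 2 * a * (q (n + h) x t - q n x t) * (v (n + h) x t - v n x t) := fun n x t => by
    have hl := ((dq (n + h) x t).fun_add (dq n x t)).const_mul a
    have hd := (dv (n + h) x t).fun_sub (dv n x t)
    have hd1 := (du (n + h) x t).fun_sub (du n x t)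
    have hd2 := (dp (n + h) x t).fun_sub (dp n x t)
    have hR := (((hd2.const_mul (2 * a / (h : ℂ))).fun_add
      (((huS (n + h)).derivSnd.hasDerivAt_fst x t).fun_sub
        ((huS n).derivSnd.hasDerivAt_fst x t))).fun_sub
      ((hd2.const_mul (2 * a)).fun_mul hd)).fun_sub ((hd1.fun_pow 2).const_mul (2 * a))
    rw [funext fun x' => eq4 n x' t] at hl
    rw [← pt, ← pt, hl.unique hR]
    push_cast; ring
  have eq6 : ∀ n x t, a * (s (n + h) x t + s n x t) =
      2 * a / (h : ℂ) * (r (n + h) x t - r n x t)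
        + (derivSnd (q (n + h)) x t - derivSnd (q n) x t)
        - 6 * a * (p (n + h) x t - p n x t) ^ 2
        - 8 * a * (q (n + h) x t - q n x t) * (u (n + h) x t - u n x t)
        - 2 * a * (r (n + h) x t - r n x t) * (v (n + h) x t - v n x t) := fun n x t => by
    have hl := ((dr (n + h) x t).fun_add (dr n x t)).const_mul a
    have hd := (dv (n + h) x t).fun_sub (dv n x t)
    have hd1 := (du (n + h) x t).fun_sub (du n x t)
    have hd2 := (dp (n + h) x t).fun_sub (dp n x t)
    have hd3 := (dq (n + h) x t).fun_sub (dq n x t)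
    have hR := (((hd3.const_mul (2 * a / (h : ℂ))).fun_add
      (((hpS (n + h)).derivSnd.hasDerivAt_fst x t).fun_sub
        ((hpS n).derivSnd.hasDerivAt_fst x t))).fun_sub
      ((hd2.const_mul (6 * a)).fun_mul hd1)).fun_sub ((hd3.const_mul (2 * a)).fun_mul hd)
    rw [funext fun x' => eq5 n x' t] at hl
    rw [← qt, ← qt, hl.unique hR]
    ring
  intro n x t
  refine ⟨?_, ?_, eq3 n x t, eq4 n x t, eq5 n x t, eq6 n x t⟩
  · change derivSnd (derivSnd (u n)) x t - _ - _ - _ - _ = 0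
    rw [utt]; ring
  · change derivSnd (derivSnd (v n)) x t - _ - _ - _ = 0
    rw [vtt]; ring
end

section
/- (Bäcklund transformation for the semi-discrete Boussinesq system.) Let h > 0, let a ∈ ℂ satisfy a² = −3, let λ, β ∈ ℂ, and let f, g : ℝ³ → ℂ be smooth functions of (n, x, t) with f nowhere zero. Suppose f satisfies (D_t² − D_x² − D_x⁴) f·f = 0 and (D_t − a D_x² + (2a/h)D_x) f_n·f_{n−h} = 0 at every point, and suppose g satisfies at every point: (i) (D_t − a D_x²) f·g = λ f g; (ii) (a D_xD_t − D_x³ − (λa + 1)D_x) f·g = 0; (iii) (D_x e^{−(h/2)D_n}) f·g = −(1/h)(e^{−(h/2)D_n} f·g) + β (e^{(h/2)D_n} f·g). Then g satisfies (D_t² − D_x² − D_x⁴) g·g = 0 and (D_t − a D_x² + (2a/h)D_x) g_n·g_{n−h} = 0 at every point. -/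
open scoped ContDiff

/-- The derivative of `F` in the constant direction `v`. -/
noncomputable def dirDeriv (v : ℝ × ℝ × ℝ) (F : ℝ × ℝ × ℝ → ℂ) : ℝ × ℝ × ℝ → ℂ :=
  fun p => fderiv ℝ F p v

section DirDeriv

variable {F G : ℝ × ℝ × ℝ → ℂ} (v w : ℝ × ℝ × ℝ)

theorem ContDiff.dirDeriv (hF : ContDiff ℝ ∞ F) : ContDiff ℝ ∞ (dirDeriv v F) :=
  (hF.fderiv_right (m := ∞) (by simp)).clm_apply contDiff_const

theorem ContDiff.mul_pi (hF : ContDiff ℝ ∞ F) (hG : ContDiff ℝ ∞ G) : ContDiff ℝ ∞ (F * G) :=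
  hF.mul hG

theorem ContDiff.add_pi (hF : ContDiff ℝ ∞ F) (hG : ContDiff ℝ ∞ G) : ContDiff ℝ ∞ (F + G) :=
  hF.add hG

theorem ContDiff.sub_pi (hF : ContDiff ℝ ∞ F) (hG : ContDiff ℝ ∞ G) : ContDiff ℝ ∞ (F - G) :=
  hF.sub hG

theorem ContDiff.const_smul_pi (hF : ContDiff ℝ ∞ F) (c : ℂ) : ContDiff ℝ ∞ (c • F) :=
  hF.const_smul c

theorem ContDiff.hasDerivAt_add_smul (hF : ContDiff ℝ ∞ F) (p : ℝ × ℝ × ℝ) (s : ℝ) :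
    HasDerivAt (fun r : ℝ => F (p + r • v)) (_root_.dirDeriv v F (p + s • v)) s := by
  have h1 : HasDerivAt (fun r : ℝ => p + r • v) v s := by
    simpa using ((hasDerivAt_id s).smul_const v).const_add p
  exact ((hF.differentiable (by simp)) _).hasFDerivAt.comp_hasDerivAt s h1

theorem dirDeriv_mul (hF : ContDiff ℝ ∞ F) (hG : ContDiff ℝ ∞ G) :
    dirDeriv v (F * G) = dirDeriv v F * G + F * dirDeriv v G := by
  funext p
  have h := fderiv_mul (hF.differentiable (by simp) p) (hG.differentiable (by simp) p)
  simp only [dirDeriv, h, Pi.add_apply, Pi.mul_apply, add_apply,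
    smul_apply, smul_eq_mul]
  ring

theorem dirDeriv_add (hF : ContDiff ℝ ∞ F) (hG : ContDiff ℝ ∞ G) :
    dirDeriv v (F + G) = dirDeriv v F + dirDeriv v G := by
  funext p
  simp [dirDeriv, fderiv_add (hF.differentiable (by simp) p) (hG.differentiable (by simp) p)]

theorem dirDeriv_sub (hF : ContDiff ℝ ∞ F) (hG : ContDiff ℝ ∞ G) :
    dirDeriv v (F - G) = dirDeriv v F - dirDeriv v G := by
  funext p
  simp [dirDeriv, fderiv_sub (hF.differentiable (by simp) p) (hG.differentiable (by simp) p)]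

theorem dirDeriv_zero : dirDeriv v 0 = 0 := by
  funext p
  simp [dirDeriv]

theorem dirDeriv_smul (hF : ContDiff ℝ ∞ F) (c : ℂ) :
    dirDeriv v (c • F) = c • dirDeriv v F := by
  funext p
  simp [dirDeriv, fderiv_const_smul (hF.differentiable (by simp) p) c]

theorem dirDeriv_comm (hF : ContDiff ℝ ∞ F) :
    dirDeriv v (dirDeriv w F) = dirDeriv w (dirDeriv v F) := by
  funext p
  have hd : DifferentiableAt ℝ (fderiv ℝ F) p :=
    (hF.fderiv_right (m := ∞) (by simp)).differentiable (by simp) p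
  have key (u u' : ℝ × ℝ × ℝ) :
      dirDeriv u (dirDeriv u' F) p = fderiv ℝ (fderiv ℝ F) p u u' := by
    change fderiv ℝ (fun q => fderiv ℝ F q u') p u = _
    rw [fderiv_clm_apply hd (differentiableAt_const u')]
    simp
  rw [key, key]
  exact (hF.contDiffAt.isSymmSndFDerivAt (by simp; exact WithTop.coe_le_coe.2 le_top)) v w

theorem dirDeriv_comp_sub (d : ℝ × ℝ × ℝ) :
    dirDeriv v (fun p => F (p - d)) = fun p => dirDeriv v F (p - d) := by
  funext p
  simp [dirDeriv, fderiv_comp_sub]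

theorem dirDeriv_mul_reflect (hF : ContDiff ℝ ∞ F) (hG : ContDiff ℝ ∞ G)
    (p q : ℝ × ℝ × ℝ) :
    deriv (fun r : ℝ => F (p + r • v) * G (q - r • v)) =
      fun r => dirDeriv v F (p + r • v) * G (q - r • v) -
        F (p + r • v) * dirDeriv v G (q - r • v) := by
  funext r
  have h1 := hF.hasDerivAt_add_smul v p r
  have h2 := (hG.hasDerivAt_add_smul v q (-r)).scomp r (hasDerivAt_neg r)
  have h3 := h1.mul h2
  simp only [Function.comp_def, neg_smul, ← sub_eq_add_neg, one_smul, mul_neg] at h3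
  exact h3.deriv

end DirDeriv

section Hirota

variable {F G : ℝ × ℝ × ℝ → ℂ} (δ n x t : ℝ)

/-- `hirotaC` for functions on the product space. -/
noncomputable def hirotaProd (a c : ℕ) (δ : ℝ) (F G : ℝ × ℝ × ℝ → ℂ) (n x t : ℝ) : ℂ :=
  hirotaC a c δ (fun n x t => F (n, x, t)) (fun n x t => G (n, x, t)) n x t

local notation "∂ₓ" => dirDeriv (0, 1, 0)
local notation "∂ₜ" => dirDeriv (0, 0, 1)

theorem hirotaProd_zero_zero :
    hirotaProd 0 0 δ F G n x t = F (n + δ, x, t) * G (n - δ, x, t) := by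
  simp [hirotaProd, hirotaC]

theorem deriv_mul_reflect_fst (hF : ContDiff ℝ ∞ F) (hG : ContDiff ℝ ∞ G) (n m x t s : ℝ) :
    deriv (fun r : ℝ => F (n, x + r, t) * G (m, x - r, s)) =
      fun r => ∂ₓ F (n, x + r, t) * G (m, x - r, s) - F (n, x + r, t) * ∂ₓ G (m, x - r, s) := by
  simpa using dirDeriv_mul_reflect (0, 1, 0) hF hG (n, x, t) (m, x, s)

theorem deriv_mul_reflect_snd (hF : ContDiff ℝ ∞ F) (hG : ContDiff ℝ ∞ G) (n m x y t : ℝ) :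
    deriv (fun r : ℝ => F (n, x, t + r) * G (m, y, t - r)) =
      fun r => ∂ₜ F (n, x, t + r) * G (m, y, t - r) - F (n, x, t + r) * ∂ₜ G (m, y, t - r) := by
  simpa using dirDeriv_mul_reflect (0, 0, 1) hF hG (n, x, t) (m, y, t)

theorem contDiff_mul_reflect_fst (hF : ContDiff ℝ ∞ F) (hG : ContDiff ℝ ∞ G) (n m x t s : ℝ) :
    ContDiff ℝ ∞ (fun r : ℝ => F (n, x + r, t) * G (m, x - r, s)) :=
  (hF.comp (by fun_prop : ContDiff ℝ ∞ fun r : ℝ => (n, x + r, t))).mul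
    (hG.comp (by fun_prop : ContDiff ℝ ∞ fun r : ℝ => (m, x - r, s)))

theorem hirotaProd_succ_zero (hF : ContDiff ℝ ∞ F) (hG : ContDiff ℝ ∞ G) (a : ℕ) :
    hirotaProd (a + 1) 0 δ F G n x t =
      hirotaProd a 0 δ (∂ₓ F) G n x t - hirotaProd a 0 δ F (∂ₓ G) n x t := by
  simp only [hirotaProd, hirotaC, iteratedDeriv_zero, add_zero, sub_zero, iteratedDeriv_succ',
    deriv_mul_reflect_fst hF hG]
  exact iteratedDeriv_fun_sub
    ((contDiff_mul_reflect_fst (hF.dirDeriv _) hG _ _ _ _ _).of_le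
      (mod_cast le_top)).contDiffAt
    ((contDiff_mul_reflect_fst hF (hG.dirDeriv _) _ _ _ _ _).of_le
      (mod_cast le_top)).contDiffAt

theorem hirotaProd_one (hF : ContDiff ℝ ∞ F) (hG : ContDiff ℝ ∞ G) (a : ℕ) :
    hirotaProd a 1 δ F G n x t =
      hirotaProd a 0 δ (∂ₜ F) G n x t - hirotaProd a 0 δ F (∂ₜ G) n x t := by
  simp only [hirotaProd, hirotaC, iteratedDeriv_zero, add_zero, sub_zero, iteratedDeriv_one,
    deriv_mul_reflect_snd hF hG]
  exact iteratedDeriv_fun_sub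
    ((contDiff_mul_reflect_fst (hF.dirDeriv _) hG _ _ _ _ _).of_le
      (mod_cast le_top)).contDiffAt
    ((contDiff_mul_reflect_fst hF (hG.dirDeriv _) _ _ _ _ _).of_le
      (mod_cast le_top)).contDiffAt

theorem hirotaProd_zero_two (hF : ContDiff ℝ ∞ F) (hG : ContDiff ℝ ∞ G) :
    hirotaProd 0 2 δ F G n x t =
      hirotaProd 0 1 δ (∂ₜ F) G n x t - hirotaProd 0 1 δ F (∂ₜ G) n x t := by
  have hs {A B : ℝ × ℝ × ℝ → ℂ} (hA : ContDiff ℝ ∞ A) (hB : ContDiff ℝ ∞ B) (n m : ℝ) :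
      DifferentiableAt ℝ (fun r : ℝ => A (n, x, t + r) * B (m, x, t - r)) 0 :=
    ((hA.comp (by fun_prop : ContDiff ℝ ∞ fun r : ℝ => (n, x, t + r))).mul
      (hB.comp (by fun_prop : ContDiff ℝ ∞ fun r : ℝ => (m, x, t - r)))).differentiable
        (by simp) _
  simp only [hirotaProd, hirotaC, iteratedDeriv_zero, add_zero, sub_zero, iteratedDeriv_one,
    iteratedDeriv_succ' (n := 1), deriv_mul_reflect_snd hF hG]
  exact deriv_fun_sub (hs (hF.dirDeriv _) hG _ _) (hs hF (hG.dirDeriv _) _ _)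

/-- The Bäcklund relations transfer the bilinear Boussinesq equation from `F` to `G`. -/
theorem boussinesq_of_backlund {a lam : ℂ} (ha : a ^ 2 = -3)
    (hF : ContDiff ℝ ∞ F) (hG : ContDiff ℝ ∞ G) (hne : ∀ p, F p ≠ 0)
    (hF1 : ∀ n x t, hirotaProd 0 2 0 F F n x t - hirotaProd 2 0 0 F F n x t
      - hirotaProd 4 0 0 F F n x t = 0)
    (hb1 : ∀ n x t, hirotaProd 0 1 0 F G n x t - a * hirotaProd 2 0 0 F G n x t
      = lam * (F (n, x, t) * G (n, x, t)))
    (hb2 : ∀ n x t, a * hirotaProd 1 1 0 F G n x t - hirotaProd 3 0 0 F G n x t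
      - (lam * a + 1) * hirotaProd 1 0 0 F G n x t = 0) :
    hirotaProd 0 2 0 G G n x t - hirotaProd 2 0 0 G G n x t
      - hirotaProd 4 0 0 G G n x t = 0 := by
  simp (maxDischargeDepth := 10) only [hirotaProd_succ_zero, hirotaProd_one,
    hirotaProd_zero_two, hirotaProd_zero_zero, hF, hG, ContDiff.dirDeriv,
    add_zero, sub_zero] at hF1 hb1 hb2 ⊢
  have e1 : ∂ₜ F * G - F * ∂ₜ G
      - a • (∂ₓ (∂ₓ F) * G - (2 : ℂ) • (∂ₓ F * ∂ₓ G) + F * ∂ₓ (∂ₓ G)) - lam • (F * G) = 0 := by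
    funext ⟨n, x, t⟩
    simp only [Pi.sub_apply, Pi.add_apply, Pi.mul_apply, Pi.smul_apply, smul_eq_mul,
      Pi.zero_apply]
    linear_combination hb1 n x t
  have e2 : a • (∂ₓ (∂ₜ F) * G - ∂ₜ F * ∂ₓ G - ∂ₓ F * ∂ₜ G + F * ∂ₓ (∂ₜ G))
      - (∂ₓ (∂ₓ (∂ₓ F)) * G - (3 : ℂ) • (∂ₓ (∂ₓ F) * ∂ₓ G) + (3 : ℂ) • (∂ₓ F * ∂ₓ (∂ₓ G))
        - F * ∂ₓ (∂ₓ (∂ₓ G)))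
      - (lam * a + 1) • (∂ₓ F * G - F * ∂ₓ G) = 0 := by
    funext ⟨n, x, t⟩
    simp only [Pi.sub_apply, Pi.add_apply, Pi.mul_apply, Pi.smul_apply, smul_eq_mul,
      Pi.zero_apply]
    linear_combination hb2 n x t
  have e1x := congrFun (congrArg ∂ₓ e1) (n, x, t)
  have e1t := congrFun (congrArg ∂ₜ e1) (n, x, t)
  have e2x := congrFun (congrArg ∂ₓ e2) (n, x, t)
  have e1 := congrFun e1 (n, x, t)
  have e2 := congrFun e2 (n, x, t)
  simp (maxDischargeDepth := 20) only [hF, hG, ContDiff.dirDeriv, ContDiff.mul_pi,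
    ContDiff.add_pi, ContDiff.sub_pi, ContDiff.const_smul_pi, dirDeriv_sub, dirDeriv_add, dirDeriv_mul, dirDeriv_smul, dirDeriv_zero,
    dirDeriv_comm (0, 0, 1) (0, 1, 0), Pi.sub_apply, Pi.add_apply, Pi.mul_apply, Pi.smul_apply,
    smul_eq_mul, Pi.zero_apply] at e1 e2 e1x e1t e2x
  refine (mul_eq_zero.1 ?_).resolve_left (pow_ne_zero 2 (hne (n, x, t)))
  set p := (n, x, t)
  let D := ∂ₓ F p * G p - F p * ∂ₓ G p
  let D' := ∂ₓ (∂ₓ F) p * G p - F p * ∂ₓ (∂ₓ G) p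
  let K := ∂ₓ (∂ₓ F) p * G p - 2 * (∂ₓ F p * ∂ₓ G p) + F p * ∂ₓ (∂ₓ G) p
  let K' := ∂ₓ (∂ₓ (∂ₓ F)) p * G p - ∂ₓ (∂ₓ F) p * ∂ₓ G p - ∂ₓ F p * ∂ₓ (∂ₓ G) p
    + F p * ∂ₓ (∂ₓ (∂ₓ G)) p
  linear_combination G p ^ 2 * hF1 n x t
    - 2 * (F p * G p * e1t - (∂ₜ F p * G p + F p * ∂ₜ G p) * e1 + F p * G p * e2x
      - (∂ₓ F p * G p + F p * ∂ₓ G p) * e2 + a * (D * e1x - D' * e1) + (D * K' - D' * K) * ha)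

/-- The Bäcklund relations transfer the semi-discrete bilinear equation from the pair
`F₁, F₂` of consecutive lattice values to the pair `G₁, G₂`. -/
theorem semidiscrete_of_backlund {a lam c β : ℂ} {F₁ F₂ G₁ G₂ : ℝ × ℝ × ℝ → ℂ}
    (hF₁ : ContDiff ℝ ∞ F₁) (hF₂ : ContDiff ℝ ∞ F₂)
    (hG₁ : ContDiff ℝ ∞ G₁) (hG₂ : ContDiff ℝ ∞ G₂)
    (hne₁ : ∀ p, F₁ p ≠ 0) (hne₂ : ∀ p, F₂ p ≠ 0)
    (hF : ∀ n x t, hirotaProd 0 1 0 F₁ F₂ n x t - a * hirotaProd 2 0 0 F₁ F₂ n x t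
      + 2 * a * c * hirotaProd 1 0 0 F₁ F₂ n x t = 0)
    (hb₁ : ∀ n x t, hirotaProd 0 1 0 F₁ G₁ n x t - a * hirotaProd 2 0 0 F₁ G₁ n x t
      = lam * (F₁ (n, x, t) * G₁ (n, x, t)))
    (hb₂ : ∀ n x t, hirotaProd 0 1 0 F₂ G₂ n x t - a * hirotaProd 2 0 0 F₂ G₂ n x t
      = lam * (F₂ (n, x, t) * G₂ (n, x, t)))
    (hb₃ : ∂ₓ F₂ * G₁ - F₂ * ∂ₓ G₁ + c • (F₂ * G₁) - β • (F₁ * G₂) = 0) :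
    hirotaProd 0 1 0 G₁ G₂ n x t - a * hirotaProd 2 0 0 G₁ G₂ n x t
      + 2 * a * c * hirotaProd 1 0 0 G₁ G₂ n x t = 0 := by
  have hF := hF n x t
  have hb₁ := hb₁ n x t
  have hb₂ := hb₂ n x t
  have e := congrFun hb₃ (n, x, t)
  have ex := congrFun (congrArg ∂ₓ hb₃) (n, x, t)
  simp (maxDischargeDepth := 10) only [hirotaProd_succ_zero, hirotaProd_one,
    hirotaProd_zero_zero, hF₁, hF₂, hG₁, hG₂, ContDiff.dirDeriv, ContDiff.mul_pi, ContDiff.add_pi,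
    ContDiff.sub_pi, ContDiff.const_smul_pi,
    add_zero, sub_zero, dirDeriv_sub, dirDeriv_add, dirDeriv_mul, dirDeriv_smul, dirDeriv_zero,
    Pi.sub_apply, Pi.add_apply, Pi.mul_apply, Pi.smul_apply, smul_eq_mul, Pi.zero_apply]
    at hF hb₁ hb₂ e ex ⊢
  refine (mul_eq_zero.1 ?_).resolve_left (mul_ne_zero (hne₁ (n, x, t)) (hne₂ (n, x, t)))
  set p := (n, x, t)
  linear_combination G₁ p * G₂ p * hF - (F₂ p * G₂ p * hb₁ - F₁ p * G₁ p * hb₂)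
    + 2 * a * (F₁ p * G₂ p * ex - (∂ₓ F₁ p * G₂ p + F₁ p * ∂ₓ G₂ p) * e)

end Hirota

/-- Proposition 3: Bäcklund transformation for the semi-discrete Boussinesq system. -/
theorem semidiscrete_Boussinesq_Backlund
    (h : ℝ) (hh : 0 < h) (a : ℂ) (ha : a^2 = -3) (lam β : ℂ) (f g : ℝ → ℝ → ℝ → ℂ)
    (hf : ContDiff ℝ (⊤ : ℕ∞) (fun pt : ℝ × ℝ × ℝ => f pt.1 pt.2.1 pt.2.2))
    (hg : ContDiff ℝ (⊤ : ℕ∞) (fun pt : ℝ × ℝ × ℝ => g pt.1 pt.2.1 pt.2.2))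
    (hfne : ∀ n x t, f n x t ≠ 0)
    (hfeq1 : ∀ n x t,
      hirotaC 0 2 0 f f n x t - hirotaC 2 0 0 f f n x t
        - hirotaC 4 0 0 f f n x t = 0)
    (hfeq2 : ∀ n x t,
      hirotaC 0 1 0 f (fun n' x' t' => f (n' - h) x' t') n x t
        - a * hirotaC 2 0 0 f (fun n' x' t' => f (n' - h) x' t') n x t
        + (2 * a / (h : ℂ)) * hirotaC 1 0 0 f (fun n' x' t' => f (n' - h) x' t') n x t = 0)
    (hbt1 : ∀ n x t,
      hirotaC 0 1 0 f g n x t - a * hirotaC 2 0 0 f g n x t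
        = lam * (f n x t * g n x t))
    (hbt2 : ∀ n x t,
      a * hirotaC 1 1 0 f g n x t - hirotaC 3 0 0 f g n x t
        - (lam * a + 1) * hirotaC 1 0 0 f g n x t = 0)
    (hbt3 : ∀ n x t,
      hirotaC 1 0 (-(h/2)) f g n x t =
        -(1/(h : ℂ)) * hirotaC 0 0 (-(h/2)) f g n x t
          + β * hirotaC 0 0 (h/2) f g n x t) :
    (∀ n x t,
      hirotaC 0 2 0 g g n x t - hirotaC 2 0 0 g g n x t
        - hirotaC 4 0 0 g g n x t = 0) ∧
    (∀ n x t,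
      hirotaC 0 1 0 g (fun n' x' t' => g (n' - h) x' t') n x t
        - a * hirotaC 2 0 0 g (fun n' x' t' => g (n' - h) x' t') n x t
        + (2 * a / (h : ℂ)) * hirotaC 1 0 0 g (fun n' x' t' => g (n' - h) x' t') n x t = 0) := by
  let F : ℝ × ℝ × ℝ → ℂ := fun p => f p.1 p.2.1 p.2.2
  let G : ℝ × ℝ × ℝ → ℂ := fun p => g p.1 p.2.1 p.2.2
  have hF : ContDiff ℝ ∞ F := hf
  have hG : ContDiff ℝ ∞ G := hg
  have hs {A : ℝ × ℝ × ℝ → ℂ} (hA : ContDiff ℝ ∞ A) :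
      ContDiff ℝ ∞ (fun p => A (p - (h, 0, 0))) := hA.comp (contDiff_id.sub contDiff_const)
  have hFne (p : ℝ × ℝ × ℝ) : F p ≠ 0 := hfne _ _ _
  have hprod (a c : ℕ) (δ : ℝ) (u v : ℝ → ℝ → ℝ → ℂ) : hirotaC a c δ u v =
      hirotaProd a c δ (fun p => u p.1 p.2.1 p.2.2) (fun p => v p.1 p.2.1 p.2.2) := rfl
  simp only [hprod] at hfeq1 hfeq2 hbt1 hbt2 hbt3 ⊢
  refine ⟨fun n x t => boussinesq_of_backlund (F := F) (G := G) (lam := lam) n x t ha hF hG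
    hFne hfeq1 hbt1 hbt2, fun n x t => ?_⟩
  have hsh (A : ℝ × ℝ × ℝ → ℂ) :
      (fun p : ℝ × ℝ × ℝ => A (p.1 - h, p.2.1, p.2.2)) = fun p => A (p - (h, 0, 0)) := by
    funext ⟨n, x, t⟩
    simp
  rw [show (fun p : ℝ × ℝ × ℝ => f (p.1 - h) p.2.1 p.2.2) = _ from hsh F] at hfeq2
  rw [show (fun p : ℝ × ℝ × ℝ => g (p.1 - h) p.2.1 p.2.2) = _ from hsh G]
  have key := semidiscrete_of_backlund (a := a) (lam := lam) (c := 1 / (h : ℂ)) (β := β) n x t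
    hF (hs hF) hG (hs hG) hFne (fun p => hFne _) ?_ hbt1 ?_ ?_
  · linear_combination key
  · intro n x t
    linear_combination hfeq2 n x t
  · intro n x t
    have e : hirotaProd 0 1 0 F G (n - h) x t - a * hirotaProd 2 0 0 F G (n - h) x t =
      lam * (F (n - h, x, t) * G (n - h, x, t)) := hbt1 (n - h) x t
    simp (maxDischargeDepth := 10) only [hirotaProd_succ_zero, hirotaProd_one, hirotaProd_zero_zero, hF, hG, hs,
      ContDiff.dirDeriv, dirDeriv_comp_sub, Prod.mk_sub_mk, sub_zero, add_zero] at e ⊢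
    exact e
  · funext ⟨n, x, t⟩
    have e : hirotaProd 1 0 (-(h/2)) F G (n - h/2) x t =
        -(1/(h : ℂ)) * hirotaProd 0 0 (-(h/2)) F G (n - h/2) x t
          + β * hirotaProd 0 0 (h/2) F G (n - h/2) x t := hbt3 (n - h/2) x t
    simp only [hirotaProd_succ_zero, hirotaProd_zero_zero, hF, hG] at e
    rw [show n - h/2 + -(h/2) = n - h by ring, show n - h/2 - -(h/2) = n by ring,
      show n - h/2 + h/2 = n by ring, show n - h/2 - h/2 = n - h by ring] at e
    simp only [dirDeriv_comp_sub, Pi.sub_apply, Pi.add_apply, Pi.mul_apply, Pi.smul_apply,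
      smul_eq_mul, Pi.zero_apply, Prod.mk_sub_mk, sub_zero]
    linear_combination e
end

section
/- Let h > 0 and let f : ℝ³ → ℝ be a smooth, everywhere positive function of (n, x, t) satisfying, at every point, D_x(D_t + D_x⁵) f·f = 0, (D_x³ − (6/h)D_x² + (12/h²)D_x) f_n·f_{n−h} = 0 and (2D_t − 3D_x⁵ + (30/h)D_x⁴ − (60/h²)D_x³) f_n·f_{n−h} = 0. Define v := ∂_x ln f, u := ∂_x v, p := ∂_x u, q := ∂_x p, r := ∂_x q, s := ∂_x r, η := ∂_x s. Write Δφ := φ(n+h) − φ(n) and Σφ := φ(n+h) + φ(n) for any of these functions (all other arguments equal). Then at every point: (i) ∂_t v + s + 30uq + 60u³ = 0; (ii) ∂_t u + η + 30pq + 30ur + 180u²p = 0; (iii) Δp + 3(Δv)(Σu) + (Δv)³ − (6/h)(Σu + (Δv)²) + (12/h²)Δv = 0; (iv) Δq + 3(Δu)(Σu) + 3(Δv)(Σp) + 3(Δv)²(Δu) − (6/h)(Σp + 2(Δv)(Δu)) + (12/h²)Δu = 0; (v) Δr + 3(Δp)(Σu) + 3(Δv)(Σq) + 6(Δu)(Σp)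 + 6(Δv)(Δu)² + 3(Δv)²(Δp) − (6/h)(Σq + 2(Δv)(Δp) + 2(Δu)²) + (12/h²)Δp = 0; (vi) Δs + 3(Δq)(Σu) + 9(Δp)(Σp) + 9(Δu)(Σq) + 3(Δv)(Σr) + 6(Δu)³ + 18(Δv)(Δu)(Δp) + 3(Δv)²(Δq) − (6/h)(Σr + 2(Δv)(Δq) + 6(Δu)(Δp)) + (12/h²)Δq = 0; (vii) Δη + 3(Δr)(Σu) + 12(Δq)(Σp) + 18(Δp)(Σq) + 12(Δu)(Σr) + 3(Δv)(Σs) + 36(Δu)²(Δp) + 18(Δv)(Δp)² + 24(Δv)(Δu)(Δq) + 3(Δv)²(Δr) − (6/h)(Σs + 2(Δv)(Δr) + 8(Δu)(Δq) + 6(Δp)²) + (12/h²)Δr = 0. -/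
/-- Derivatives of `E` with logarithmic derivative `a`, up to order three. -/
lemma iteratedDeriv_of_logDeriv {E a b c : ℝ → ℝ}
    (hE : ∀ r, HasDerivAt E (E r * a r) r) (ha : ∀ r, HasDerivAt a (b r) r)
    (hb : ∀ r, HasDerivAt b (c r) r) :
    iteratedDeriv 1 E = (fun r => E r * a r) ∧
    iteratedDeriv 2 E = (fun r => E r * (b r + a r ^ 2)) ∧
    iteratedDeriv 3 E = (fun r => E r * (c r + 3 * a r * b r + a r ^ 3)) := by
  have h1 : iteratedDeriv 1 E = fun r => E r * a r := by
    rw [iteratedDeriv_one]; exact funext fun r => (hE r).deriv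
  have h2 : iteratedDeriv 2 E = fun r => E r * (b r + a r ^ 2) := by
    rw [iteratedDeriv_succ, h1]
    refine funext fun r => (((hE r).mul (ha r)).congr_deriv ?_).deriv
    ring
  refine ⟨h1, h2, ?_⟩
  rw [iteratedDeriv_succ, h2]
  refine funext fun r => (((hE r).mul ((hb r).add ((ha r).pow 2))).congr_deriv ?_).deriv
  simp only [Pi.add_apply, Pi.pow_apply]
  push_cast
  ring

/-- Sixth derivative of `E` with logarithmic derivative `a`, where the odd-order derivatives of
`log E` vanish. -/
lemma iteratedDeriv_six_of_logDeriv {E a b c d e g : ℝ → ℝ}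
    (hE : ∀ r, HasDerivAt E (E r * a r) r) (ha : ∀ r, HasDerivAt a (b r) r)
    (hb : ∀ r, HasDerivAt b (c r) r) (hc : ∀ r, HasDerivAt c (d r) r)
    (hd : ∀ r, HasDerivAt d (e r) r) (he : ∀ r, HasDerivAt e (g r) r)
    {r₀ : ℝ} (ha₀ : a r₀ = 0) (hc₀ : c r₀ = 0) :
    iteratedDeriv 6 E r₀ = E r₀ * (g r₀ + 15 * b r₀ * d r₀ + 15 * b r₀ ^ 3) := by
  have h3 := (iteratedDeriv_of_logDeriv hE ha hb).2.2
  have h4 : iteratedDeriv 4 E = fun r =>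
      E r * (d r + 4 * (a r * c r) + 3 * b r ^ 2 + 6 * (a r ^ 2 * b r) + a r ^ 4) := by
    rw [iteratedDeriv_succ, h3]
    refine funext fun r => (((hE r).mul (((hc r).add (((ha r).const_mul 3).mul (hb r))).add
      ((ha r).pow 3))).congr_deriv ?_).deriv
    simp only [Pi.add_apply, Pi.pow_apply, Pi.mul_apply]
    push_cast
    ring
  have h5 : iteratedDeriv 5 E = fun r => E r * (e r + 5 * (a r * d r) + 10 * (b r * c r)
      + 15 * (a r * b r ^ 2) + 10 * (a r ^ 2 * c r) + 10 * (a r ^ 3 * b r) + a r ^ 5) := by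
    rw [iteratedDeriv_succ, h4]
    refine funext fun r => (((hE r).mul (((((hd r).add (((ha r).mul (hc r)).const_mul 4)).add
      (((hb r).pow 2).const_mul 3)).add ((((ha r).pow 2).mul (hb r)).const_mul 6)).add
      ((ha r).pow 4))).congr_deriv ?_).deriv
    simp only [Pi.add_apply, Pi.pow_apply, Pi.mul_apply]
    push_cast
    ring
  rw [iteratedDeriv_succ, h5]
  refine (((hE r₀).mul (((((((he r₀).add (((ha r₀).mul (hd r₀)).const_mul 5)).add
      (((hb r₀).mul (hc r₀)).const_mul 10)).add
      (((ha r₀).mul ((hb r₀).pow 2)).const_mul 15)).add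
      ((((ha r₀).pow 2).mul (hc r₀)).const_mul 10)).add
      ((((ha r₀).pow 3).mul (hb r₀)).const_mul 10)).add
      ((ha r₀).pow 5))).congr_deriv ?_).deriv
  simp only [Pi.add_apply, Pi.pow_apply, Pi.mul_apply, ha₀, hc₀]
  push_cast
  ring

/-- Joint smoothness of a function of `(n, x, t)`. -/
def Smooth3 (g : ℝ → ℝ → ℝ → ℝ) : Prop :=
  ContDiff ℝ (⊤ : ℕ∞) (fun pt : ℝ × ℝ × ℝ => g pt.1 pt.2.1 pt.2.2)

namespace Smooth3

variable {g : ℝ → ℝ → ℝ → ℝ}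

lemma hasDerivAt_x_fderiv (hg : Smooth3 g) (n x t : ℝ) :
    HasDerivAt (fun x' => g n x' t)
      (fderiv ℝ (fun pt : ℝ × ℝ × ℝ => g pt.1 pt.2.1 pt.2.2) (n, x, t) (0, 1, 0)) x := by
  have h1 := ((ContDiff.differentiable hg (by simp)) (n, x, t)).hasFDerivAt
  have h2 : HasDerivAt (fun x' : ℝ => ((n, x', t) : ℝ × ℝ × ℝ)) (0, 1, 0) x :=
    (hasDerivAt_const x n).prodMk ((hasDerivAt_id x).prodMk (hasDerivAt_const x t))
  exact h1.comp_hasDerivAt x h2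

lemma hasDerivAt_t_fderiv (hg : Smooth3 g) (n x t : ℝ) :
    HasDerivAt (fun t' => g n x t')
      (fderiv ℝ (fun pt : ℝ × ℝ × ℝ => g pt.1 pt.2.1 pt.2.2) (n, x, t) (0, 0, 1)) t := by
  have h1 := ((ContDiff.differentiable hg (by simp)) (n, x, t)).hasFDerivAt
  have h2 : HasDerivAt (fun t' : ℝ => ((n, x, t') : ℝ × ℝ × ℝ)) (0, 0, 1) t :=
    (hasDerivAt_const t n).prodMk ((hasDerivAt_const t x).prodMk (hasDerivAt_id t))
  exact h1.comp_hasDerivAt t h2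

lemma hasDerivAt_x (hg : Smooth3 g) (n x t : ℝ) :
    HasDerivAt (fun x' => g n x' t) (deriv (fun x' => g n x' t) x) x :=
  (hg.hasDerivAt_x_fderiv n x t).differentiableAt.hasDerivAt

lemma hasDerivAt_t (hg : Smooth3 g) (n x t : ℝ) :
    HasDerivAt (fun t' => g n x t') (deriv (fun t' => g n x t') t) t :=
  (hg.hasDerivAt_t_fderiv n x t).differentiableAt.hasDerivAt

lemma deriv_x (hg : Smooth3 g) : Smooth3 (fun n x t => deriv (fun x' => g n x' t) x) := by
  simp only [Smooth3, (hg.hasDerivAt_x_fderiv _ _ _).deriv]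
  exact (ContDiff.fderiv_right hg (by simp)).clm_apply contDiff_const

lemma deriv_t (hg : Smooth3 g) : Smooth3 (fun n x t => deriv (fun t' => g n x t') t) := by
  simp only [Smooth3, (hg.hasDerivAt_t_fderiv _ _ _).deriv]
  exact (ContDiff.fderiv_right hg (by simp)).clm_apply contDiff_const

lemma deriv_t_deriv_x (hg : Smooth3 g) (n x t : ℝ) :
    deriv (fun t' => deriv (fun x' => g n x' t') x) t =
      deriv (fun x' => deriv (fun t' => g n x' t') t) x := by
  have hG : ContDiff ℝ (⊤ : ℕ∞)
      (fderiv ℝ (fun pt : ℝ × ℝ × ℝ => g pt.1 pt.2.1 pt.2.2)) := ContDiff.fderiv_right hg (by simp)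
  have hd := (hG.differentiable (by simp) (n, x, t)).hasFDerivAt
  have hx := (hg.deriv_x.hasDerivAt_t_fderiv n x t).deriv
  have ht := (hg.deriv_t.hasDerivAt_x_fderiv n x t).deriv
  simp only [(hg.hasDerivAt_x_fderiv _ _ _).deriv, (hg.hasDerivAt_t_fderiv _ _ _).deriv] at hx ht ⊢
  rw [hx, ht, (hd.clm_apply (hasFDerivAt_const _ _)).fderiv,
    (hd.clm_apply (hasFDerivAt_const _ _)).fderiv]
  have hsymm := (ContDiff.contDiffAt hg (x := (n, x, t))).isSymmSndFDerivAt
    (by simpa using WithTop.coe_le_coe.2 (le_top : (2 : ℕ∞) ≤ ⊤))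
  simpa using hsymm (0, 0, 1) (0, 1, 0)

end Smooth3

/-- A pair of reflected arguments: the derivative of `A (x + r) ± B (x - r)` in `r`. -/
lemma hasDerivAt_add_sub {A B A' B' : ℝ → ℝ} (hA : ∀ x, HasDerivAt A (A' x) x)
    (hB : ∀ x, HasDerivAt B (B' x) x) (x r : ℝ) :
    HasDerivAt (fun r => A (x + r) + B (x - r)) (A' (x + r) - B' (x - r)) r ∧
    HasDerivAt (fun r => A (x + r) - B (x - r)) (A' (x + r) + B' (x - r)) r := by
  have h1 := (hA (x + r)).comp_const_add x r
  have h2 := (hB (x - r)).comp_const_sub x r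
  exact ⟨(h1.add h2).congr_deriv (by ring), (h1.sub h2).congr_deriv (by ring)⟩

/-- The reflected product of two functions with logarithmic derivatives `A'` and `B'`. -/
lemma hasDerivAt_mul_reflect_s7 {f g A' B' : ℝ → ℝ} (hf : ∀ x, HasDerivAt f (f x * A' x) x)
    (hg : ∀ x, HasDerivAt g (g x * B' x) x) (x r : ℝ) :
    HasDerivAt (fun r => f (x + r) * g (x - r))
      (f (x + r) * g (x - r) * (A' (x + r) - B' (x - r))) r := by
  have h1 := (hf (x + r)).comp_const_add x r
  have h2 := (hg (x - r)).comp_const_sub x r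
  exact (h1.mul h2).congr_deriv (by ring)

/-- Theorem 4 (nonlinear form of the semi-discrete Sawada–Kotera system). -/
theorem semidiscrete_SK_nonlinear_form
    (h : ℝ) (hh : 0 < h) (f : ℝ → ℝ → ℝ → ℝ)
    (hf : ContDiff ℝ (⊤ : ℕ∞) (fun pt : ℝ × ℝ × ℝ => f pt.1 pt.2.1 pt.2.2))
    (hfpos : ∀ n x t, 0 < f n x t)
    (heq1 : ∀ n x t,
      hirota3 1 1 0 f f n x t + hirota3 6 0 0 f f n x t = 0)
    (heq2 : ∀ n x t,
      hirota3 3 0 0 f (fun n' x' t' => f (n' - h) x' t') n x t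
        - (6/h) * hirota3 2 0 0 f (fun n' x' t' => f (n' - h) x' t') n x t
        + (12/h^2) * hirota3 1 0 0 f (fun n' x' t' => f (n' - h) x' t') n x t = 0)
    (heq3 : ∀ n x t,
      2 * hirota3 0 1 0 f (fun n' x' t' => f (n' - h) x' t') n x t
        - 3 * hirota3 5 0 0 f (fun n' x' t' => f (n' - h) x' t') n x t
        + (30/h) * hirota3 4 0 0 f (fun n' x' t' => f (n' - h) x' t') n x t
        - (60/h^2) * hirota3 3 0 0 f (fun n' x' t' => f (n' - h) x' t') n x t = 0)
    (v u p q r s η : ℝ → ℝ → ℝ → ℝ)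
    (hv : ∀ n x t, v n x t = deriv (fun x' => Real.log (f n x' t)) x)
    (hu : ∀ n x t, u n x t = deriv (fun x' => v n x' t) x)
    (hp : ∀ n x t, p n x t = deriv (fun x' => u n x' t) x)
    (hq : ∀ n x t, q n x t = deriv (fun x' => p n x' t) x)
    (hr : ∀ n x t, r n x t = deriv (fun x' => q n x' t) x)
    (hs : ∀ n x t, s n x t = deriv (fun x' => r n x' t) x)
    (hη : ∀ n x t, η n x t = deriv (fun x' => s n x' t) x) :
    ∀ n x t,
      let Δv := v (n + h) x t - v n x t
      let Δu := u (n + h) x t - u n x t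
      let Δp := p (n + h) x t - p n x t
      let Δq := q (n + h) x t - q n x t
      let Δr := r (n + h) x t - r n x t
      let Δs := s (n + h) x t - s n x t
      let Δη := η (n + h) x t - η n x t
      let Su := u (n + h) x t + u n x t
      let Sp := p (n + h) x t + p n x t
      let Sq := q (n + h) x t + q n x t
      let Sr := r (n + h) x t + r n x t
      let Ss := s (n + h) x t + s n x t
      (deriv (fun t' => v n x t') t + s n x t
        + 30 * u n x t * q n x t + 60 * (u n x t)^3 = 0) ∧
      (deriv (fun t' => u n x t') t + η n x t
        + 30 * p n x t * q n x t + 30 * u n x t * r n x t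
        + 180 * (u n x t)^2 * p n x t = 0) ∧
      (Δp + 3 * Δv * Su + Δv^3 - (6/h) * (Su + Δv^2) + (12/h^2) * Δv = 0) ∧
      (Δq + 3 * Δu * Su + 3 * Δv * Sp + 3 * Δv^2 * Δu
        - (6/h) * (Sp + 2 * Δv * Δu) + (12/h^2) * Δu = 0) ∧
      (Δr + 3 * Δp * Su + 3 * Δv * Sq + 6 * Δu * Sp + 6 * Δv * Δu^2 + 3 * Δv^2 * Δp
        - (6/h) * (Sq + 2 * Δv * Δp + 2 * Δu^2) + (12/h^2) * Δp = 0) ∧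
      (Δs + 3 * Δq * Su + 9 * Δp * Sp + 9 * Δu * Sq + 3 * Δv * Sr + 6 * Δu^3
        + 18 * Δv * Δu * Δp + 3 * Δv^2 * Δq
        - (6/h) * (Sr + 2 * Δv * Δq + 6 * Δu * Δp) + (12/h^2) * Δq = 0) ∧
      (Δη + 3 * Δr * Su + 12 * Δq * Sp + 18 * Δp * Sq + 12 * Δu * Sr + 3 * Δv * Ss
        + 36 * Δu^2 * Δp + 18 * Δv * Δp^2 + 24 * Δv * Δu * Δq + 3 * Δv^2 * Δr
        - (6/h) * (Ss + 2 * Δv * Δr + 8 * Δu * Δq + 6 * Δp^2) + (12/h^2) * Δr = 0) := by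
  have hL : Smooth3 fun n x t => Real.log (f n x t) :=
    ContDiff.log hf fun pt => (hfpos _ _ _).ne'
  have ev : v = fun n x t => deriv (fun x' => Real.log (f n x' t)) x := by
    funext n x t; exact hv n x t
  have eu : u = fun n x t => deriv (fun x' => v n x' t) x := by funext n x t; exact hu n x t
  have ep : p = fun n x t => deriv (fun x' => u n x' t) x := by funext n x t; exact hp n x t
  have eq : q = fun n x t => deriv (fun x' => p n x' t) x := by funext n x t; exact hq n x t
  have er : r = fun n x t => deriv (fun x' => q n x' t) x := by funext n x t; exact hr n x t
  have es : s = fun n x t => deriv (fun x' => r n x' t) x := by funext n x t; exact hs n x t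
  have sv : Smooth3 v := ev ▸ hL.deriv_x
  have su : Smooth3 u := eu ▸ sv.deriv_x
  have sp : Smooth3 p := ep ▸ su.deriv_x
  have sq : Smooth3 q := eq ▸ sp.deriv_x
  have sr : Smooth3 r := er ▸ sq.deriv_x
  have ss : Smooth3 s := es ▸ sr.deriv_x
  have dv : ∀ n x t, HasDerivAt (fun x' => v n x' t) (u n x t) x := fun n x t =>
    hu n x t ▸ sv.hasDerivAt_x n x t
  have du : ∀ n x t, HasDerivAt (fun x' => u n x' t) (p n x t) x := fun n x t =>
    hp n x t ▸ su.hasDerivAt_x n x t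
  have dp : ∀ n x t, HasDerivAt (fun x' => p n x' t) (q n x t) x := fun n x t =>
    hq n x t ▸ sp.hasDerivAt_x n x t
  have dq : ∀ n x t, HasDerivAt (fun x' => q n x' t) (r n x t) x := fun n x t =>
    hr n x t ▸ sq.hasDerivAt_x n x t
  have dr : ∀ n x t, HasDerivAt (fun x' => r n x' t) (s n x t) x := fun n x t =>
    hs n x t ▸ sr.hasDerivAt_x n x t
  have ds : ∀ n x t, HasDerivAt (fun x' => s n x' t) (η n x t) x := fun n x t =>
    hη n x t ▸ ss.hasDerivAt_x n x t
  have df : ∀ n x t, HasDerivAt (fun x' => f n x' t) (f n x t * v n x t) x := fun n x t => by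
    have h1 := hL.hasDerivAt_x n x t
    rw [← hv] at h1
    simpa [Real.exp_log (hfpos _ _ _)] using h1.exp
  set w : ℝ → ℝ → ℝ → ℝ := fun n x t => deriv (fun t' => Real.log (f n x t')) t
  have sw : Smooth3 w := hL.deriv_t
  have dft : ∀ n x t, HasDerivAt (fun t' => f n x t') (f n x t * w n x t) t := fun n x t => by
    simpa [Real.exp_log (hfpos _ _ _)] using (hL.hasDerivAt_t n x t).exp
  have vt : ∀ n x t, deriv (fun t' => v n x t') t = deriv (fun x' => w n x' t) x := fun n x t => by
    rw [ev]; exact hL.deriv_t_deriv_x n x t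
  -- the evolution equations
  have e1 : ∀ n x t, deriv (fun t' => v n x t') t + s n x t
      + 30 * u n x t * q n x t + 60 * (u n x t)^3 = 0 := by
    intro n x t
    have h6 : hirota3 6 0 0 f f n x t = f n x t * f n x t *
        (2 * s n x t + 60 * u n x t * q n x t + 120 * u n x t ^ 3) := by
      simp only [hirota3, iteratedDeriv_zero, add_zero, sub_zero]
      rw [iteratedDeriv_six_of_logDeriv
        (hasDerivAt_mul_reflect_s7 (df n · t) (df n · t) x)
        (fun r => (hasDerivAt_add_sub (dv n · t) (dv n · t) x r).2)
        (fun r => (hasDerivAt_add_sub (du n · t) (du n · t) x r).1)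
        (fun r => (hasDerivAt_add_sub (dp n · t) (dp n · t) x r).2)
        (fun r => (hasDerivAt_add_sub (dq n · t) (dq n · t) x r).1)
        (fun r => (hasDerivAt_add_sub (dr n · t) (dr n · t) x r).2) (by simp) (by simp)]
      simp only [add_zero, sub_zero]
      ring
    have h11 : hirota3 1 1 0 f f n x t =
        f n x t * f n x t * (2 * deriv (fun t' => v n x t') t) := by
      simp only [hirota3, iteratedDeriv_one, add_zero, sub_zero]
      have hin : ∀ y, deriv (fun w => f n (x + y) (t + w) * f n (x - y) (t - w)) 0 =
          f n (x + y) t * f n (x - y) t * (w n (x + y) t - w n (x - y) t) := fun y => by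
        simpa using (hasDerivAt_mul_reflect_s7 (dft n (x + y)) (dft n (x - y)) t 0).deriv
      simp only [hin]
      have hout := ((hasDerivAt_mul_reflect_s7 (df n · t) (df n · t) x 0).mul
        (hasDerivAt_add_sub (sw.hasDerivAt_x n · t) (sw.hasDerivAt_x n · t) x 0).2).deriv
      refine hout.trans ?_
      rw [vt]
      simp only [add_zero, sub_zero]
      ring
    have h1 := heq1 n x t
    rw [h6, h11, ← mul_add] at h1
    have := (mul_eq_zero.mp h1).resolve_left (mul_pos (hfpos n x t) (hfpos n x t)).ne'
    linarith
  -- the difference relation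
  have e3 : ∀ n x t,
      (p (n + h) x t - p n x t) + 3 * (v (n + h) x t - v n x t) * (u (n + h) x t + u n x t)
        + (v (n + h) x t - v n x t)^3
        - (6/h) * ((u (n + h) x t + u n x t) + (v (n + h) x t - v n x t)^2)
        + (12/h^2) * (v (n + h) x t - v n x t) = 0 := by
    intro n x t
    obtain ⟨h1, h2, h3⟩ := iteratedDeriv_of_logDeriv
      (hasDerivAt_mul_reflect_s7 (df (n + h) · t) (df n · t) x)
      (fun r => (hasDerivAt_add_sub (dv (n + h) · t) (dv n · t) x r).2)
      (fun r => (hasDerivAt_add_sub (du (n + h) · t) (du n · t) x r).1)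
    have hH := heq2 (n + h) x t
    simp only [hirota3, iteratedDeriv_zero, add_zero, sub_zero, add_sub_cancel_right,
      h1, h2, h3] at hH
    have hpos := mul_pos (hfpos (n + h) x t) (hfpos n x t)
    refine (mul_eq_zero.mp (?_ : f (n + h) x t * f n x t * _ = 0)).resolve_left hpos.ne'
    linear_combination hH
  have key : ∀ {A : ℝ → ℝ} {A' x : ℝ}, (∀ x, A x = 0) → HasDerivAt A A' x → A' = 0 := by
    intro A A' x h0 hA
    obtain rfl : A = fun _ => 0 := funext h0
    exact hA.unique (hasDerivAt_const x 0)
  have Dv : ∀ n x t, HasDerivAt (fun x => v (n + h) x t - v n x t)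
      (u (n + h) x t - u n x t) x := fun n x t => (dv _ x t).sub (dv _ x t)
  have Du : ∀ n x t, HasDerivAt (fun x => u (n + h) x t - u n x t)
      (p (n + h) x t - p n x t) x := fun n x t => (du _ x t).sub (du _ x t)
  have Dp : ∀ n x t, HasDerivAt (fun x => p (n + h) x t - p n x t)
      (q (n + h) x t - q n x t) x := fun n x t => (dp _ x t).sub (dp _ x t)
  have Dq : ∀ n x t, HasDerivAt (fun x => q (n + h) x t - q n x t)
      (r (n + h) x t - r n x t) x := fun n x t => (dq _ x t).sub (dq _ x t)
  have Dr : ∀ n x t, HasDerivAt (fun x => r (n + h) x t - r n x t)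
      (s (n + h) x t - s n x t) x := fun n x t => (dr _ x t).sub (dr _ x t)
  have Ds : ∀ n x t, HasDerivAt (fun x => s (n + h) x t - s n x t)
      (η (n + h) x t - η n x t) x := fun n x t => (ds _ x t).sub (ds _ x t)
  have Su : ∀ n x t, HasDerivAt (fun x => u (n + h) x t + u n x t)
      (p (n + h) x t + p n x t) x := fun n x t => (du _ x t).add (du _ x t)
  have Sp : ∀ n x t, HasDerivAt (fun x => p (n + h) x t + p n x t)
      (q (n + h) x t + q n x t) x := fun n x t => (dp _ x t).add (dp _ x t)
  have Sq : ∀ n x t, HasDerivAt (fun x => q (n + h) x t + q n x t)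
      (r (n + h) x t + r n x t) x := fun n x t => (dq _ x t).add (dq _ x t)
  have Sr : ∀ n x t, HasDerivAt (fun x => r (n + h) x t + r n x t)
      (s (n + h) x t + s n x t) x := fun n x t => (dr _ x t).add (dr _ x t)
  have e4 : ∀ n x t,
      (q (n + h) x t - q n x t) + 3 * (u (n + h) x t - u n x t) * (u (n + h) x t + u n x t)
        + 3 * (v (n + h) x t - v n x t) * (p (n + h) x t + p n x t)
        + 3 * (v (n + h) x t - v n x t)^2 * (u (n + h) x t - u n x t)
        - (6/h) * ((p (n + h) x t + p n x t)
          + 2 * (v (n + h) x t - v n x t) * (u (n + h) x t - u n x t))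
        + (12/h^2) * (u (n + h) x t - u n x t) = 0 := by
    intro n x t
    refine key (e3 n · t) (((((((Dp n x t).add (((Dv n x t).const_mul 3).mul (Su n x t))).add
      ((Dv n x t).pow 3)).sub (((Su n x t).add ((Dv n x t).pow 2)).const_mul (6/h))).add
      ((Dv n x t).const_mul (12/h^2)))).congr_deriv ?_)
    push_cast
    ring
  have e5 : ∀ n x t,
      (r (n + h) x t - r n x t) + 3 * (p (n + h) x t - p n x t) * (u (n + h) x t + u n x t)
        + 3 * (v (n + h) x t - v n x t) * (q (n + h) x t + q n x t)
        + 6 * (u (n + h) x t - u n x t) * (p (n + h) x t + p n x t)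
        + 6 * (v (n + h) x t - v n x t) * (u (n + h) x t - u n x t)^2
        + 3 * (v (n + h) x t - v n x t)^2 * (p (n + h) x t - p n x t)
        - (6/h) * ((q (n + h) x t + q n x t)
          + 2 * (v (n + h) x t - v n x t) * (p (n + h) x t - p n x t)
          + 2 * (u (n + h) x t - u n x t)^2)
        + (12/h^2) * (p (n + h) x t - p n x t) = 0 := by
    intro n x t
    refine key (e4 n · t) (((((((Dq n x t).add (((Du n x t).const_mul 3).mul (Su n x t))).add
      (((Dv n x t).const_mul 3).mul (Sp n x t))).add
      ((((Dv n x t).pow 2).const_mul 3).mul (Du n x t))).sub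
      (((Sp n x t).add (((Dv n x t).const_mul 2).mul (Du n x t))).const_mul (6/h))).add
      ((Du n x t).const_mul (12/h^2))).congr_deriv ?_)
    simp only [Pi.pow_apply]
    push_cast
    ring
  have e6 : ∀ n x t,
      (s (n + h) x t - s n x t) + 3 * (q (n + h) x t - q n x t) * (u (n + h) x t + u n x t)
        + 9 * (p (n + h) x t - p n x t) * (p (n + h) x t + p n x t)
        + 9 * (u (n + h) x t - u n x t) * (q (n + h) x t + q n x t)
        + 3 * (v (n + h) x t - v n x t) * (r (n + h) x t + r n x t)
        + 6 * (u (n + h) x t - u n x t)^3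
        + 18 * (v (n + h) x t - v n x t) * (u (n + h) x t - u n x t) * (p (n + h) x t - p n x t)
        + 3 * (v (n + h) x t - v n x t)^2 * (q (n + h) x t - q n x t)
        - (6/h) * ((r (n + h) x t + r n x t)
          + 2 * (v (n + h) x t - v n x t) * (q (n + h) x t - q n x t)
          + 6 * (u (n + h) x t - u n x t) * (p (n + h) x t - p n x t))
        + (12/h^2) * (q (n + h) x t - q n x t) = 0 := by
    intro n x t
    refine key (e5 n · t) (((((((((Dr n x t).add (((Dp n x t).const_mul 3).mul (Su n x t))).add
      (((Dv n x t).const_mul 3).mul (Sq n x t))).add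
      (((Du n x t).const_mul 6).mul (Sp n x t))).add
      (((Dv n x t).const_mul 6).mul ((Du n x t).pow 2))).add
      ((((Dv n x t).pow 2).const_mul 3).mul (Dp n x t))).sub
      ((((Sq n x t).add (((Dv n x t).const_mul 2).mul (Dp n x t))).add
        (((Du n x t).pow 2).const_mul 2)).const_mul (6/h))).add
      ((Dp n x t).const_mul (12/h^2))).congr_deriv ?_)
    simp only [Pi.pow_apply]
    push_cast
    ring
  intro n x t
  refine ⟨e1 n x t, ?_, e3 n x t, e4 n x t, e5 n x t, e6 n x t, ?_⟩
  · have hut : deriv (fun t' => u n x t') t = deriv (fun x' => deriv (fun t' => v n x' t') t) x := by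
      rw [eu]; exact sv.deriv_t_deriv_x n x t
    rw [hut]
    refine key (e1 n · t) (((((sv.deriv_t.hasDerivAt_x n x t).add (ds n x t)).add
      (((du n x t).const_mul 30).mul (dq n x t))).add
      (((du n x t).pow 3).const_mul 60)).congr_deriv ?_)
    push_cast
    ring
  · refine key (e6 n · t) (((((((((((Ds n x t).add
      (((Dq n x t).const_mul 3).mul (Su n x t))).add
      (((Dp n x t).const_mul 9).mul (Sp n x t))).add
      (((Du n x t).const_mul 9).mul (Sq n x t))).add
      (((Dv n x t).const_mul 3).mul (Sr n x t))).add
      (((Du n x t).pow 3).const_mul 6)).add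
      ((((Dv n x t).const_mul 18).mul (Du n x t)).mul (Dp n x t))).add
      ((((Dv n x t).pow 2).const_mul 3).mul (Dq n x t))).sub
      ((((Sr n x t).add (((Dv n x t).const_mul 2).mul (Dq n x t))).add
        (((Du n x t).const_mul 6).mul (Dp n x t))).const_mul (6/h))).add
      ((Dq n x t).const_mul (12/h^2))).congr_deriv ?_)
    simp only [Pi.pow_apply, Pi.mul_apply]
    push_cast
    ring
end
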